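/- (Wegner estimate for d = 1, 2, 3.) Let d ∈ {1,2,3} and let V_hi be a hierarchical potential with barrier height h > 4d+1 and well density N. For any 0 < β ≤ 1 there exist q > 0, ε > 0 and a scale k_in > 0 (all depending only on h, β, α, d₀, N) such that for all k ≥ k_in and all E ∈ [−ι/2, 4d+β+ι/2]: ℙ( dist(Spec(H_Λ), E) < exp(−d_{k+1}^{1−ε}) ) ≤ d_{k+1}^{−q}, where Λ is either Λ̄_k or Λ̄_k^s (2 ≤ s ≤ N) and the probability is taken only over the Bernoulli variables ω(x) with x ∈ Λ. -/

import Mathlib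

noncomputable section

open scoped ENNReal

namespace HierABM

/-- Sites of the lattice `ℤ^d`. -/
abbrev Site (d : ℕ) := Fin d → ℤ

variable {d : ℕ}

/-- The `ℓ∞`-norm of a lattice site (as a natural number). -/
def linf (x : Site d) : ℕ := Finset.univ.sup fun i => (x i).natAbs

/-- The `ℓ∞`-distance between two lattice sites (as a natural number). -/
def linfDist (x y : Site d) : ℕ := Finset.univ.sup fun i => (x i - y i).natAbs

/-- The `ℓ¹`-distance between two lattice sites; `x ∼ y` means `l1dist x y = 1`. -/
def l1dist (x y : Site d) : ℤ := ∑ i, |x i - y i|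

/-- The `i`-th standard basis vector of `ℤ^d`. -/
def unit (i : Fin d) : Site d := fun j => if j = i then 1 else 0

/-- The discrete Laplacian `Δf(x) = ∑_{y ∼ x} f(y)`. -/
def discLap (f : Site d → ℝ) (x : Site d) : ℝ :=
  ∑ i : Fin d, (f (x + unit i) + f (x - unit i))

/-- The pointwise action of `H(ω) = 2d - Δ + V_hi + β ω`. -/
def hamAct (Vhi : Site d → ℝ) (β : ℝ) (ω : Site d → Bool)
    (f : Site d → ℝ) (x : Site d) : ℝ :=
  (2 * d + Vhi x + β * (if ω x then 1 else 0)) * f x - discLap f x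

/-- The Newtonian scales `d_k = d₀^(α^k)`, i.e. `d_{k+1} = d_k^α`. -/
def nscale (d₀ α : ℝ) (k : ℕ) : ℝ := d₀ ^ (α ^ k)

/-- The block `Λ_k(j) = {x : |x - j|_∞ ≤ 2⌊3 d_k⌋}`. -/
def LambdaS (d₀ α : ℝ) (k : ℕ) (j : Site d) : Set (Site d) :=
  {x | (linfDist x j : ℤ) ≤ 2 * ⌊3 * nscale d₀ α k⌋}

/-- `diam A ≤ r` in the `ℓ∞`-metric. -/
def diamLE (A : Set (Site d)) (r : ℤ) : Prop :=
  ∀ a ∈ A, ∀ b ∈ A, (linfDist a b : ℤ) ≤ r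

/-- `dist(A, B) ≥ r` in the `ℓ∞`-metric. -/
def setDistGE (A B : Set (Site d)) (r : ℝ) : Prop :=
  ∀ a ∈ A, ∀ b ∈ B, r ≤ (linfDist a b : ℝ)

/-- The potential with zero set `W` is `(k, N)`-hierarchical in `Λ_k(j)`. -/
def IsHierIn (d₀ α : ℝ) (N : ℕ) (W : Set (Site d)) : ℕ → Site d → Prop
  | 0, _ => True
  | 1, j => ∃ (m : ℕ) (C : Fin (m + 1) → Set (Site d)),
      m + 1 ≤ N ∧
      W ∩ LambdaS d₀ α 1 j = ⋃ s, C s ∧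
      (∀ s, diamLE (C s) (4 * ⌊3 * d₀⌋)) ∧
      C 0 ⊆ LambdaS d₀ α 0 j ∧
      (∀ s t, s ≠ t → setDistGE (C s) (C t) (2 * nscale d₀ α 1))
  | (k + 2), j => ∃ (m : ℕ) (C : Fin (m + 1) → Set (Site d)),
      m + 1 ≤ N ∧
      W ∩ LambdaS d₀ α (k + 2) j = ⋃ s, C s ∧
      C 0 ⊆ LambdaS d₀ α (k + 1) j ∧
      (∀ s t, s ≠ t → setDistGE (C s) (C t) (2 * nscale d₀ α (k + 2))) ∧
      IsHierIn d₀ α N W (k + 1) j ∧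
      (∀ s : Fin (m + 1), s ≠ 0 → ∃ js : Site d,
        LambdaS d₀ α (k + 1) js ⊆ LambdaS d₀ α (k + 2) j ∧
        C s ⊆ LambdaS d₀ α (k + 1) js ∧
        IsHierIn d₀ α N W (k + 1) js)

/-- `V_hi` is a hierarchical potential with scales `d₀, α`, well density `N`
and barrier height `h`. -/
def IsHierPot (d₀ α : ℝ) (N : ℕ) (h : ℝ) (Vhi : Site d → ℝ) : Prop :=
  (∀ x, Vhi x = 0 ∨ Vhi x = h) ∧
  ∀ k : ℕ, 1 ≤ k → IsHierIn d₀ α N {x | Vhi x = 0} k 0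

/-- The parameter `ι = min{1/100, (h - 4d - β)/2}`. -/
def iota (d : ℕ) (h β : ℝ) : ℝ := min (1 / 100) ((h - 4 * d - β) / 2)

/-- `ℙ` is the i.i.d. Bernoulli(1/2) product measure on `{0,1}^{ℤ^d}`. -/
def IsBernoulliProduct (d : ℕ) (ℙ : MeasureTheory.Measure (Site d → Bool)) : Prop :=
  ∀ (S : Finset (Site d)) (v : Site d → Bool),
    ℙ {ω | ∀ x ∈ S, ω x = v x} = (1 / 2 : ℝ≥0∞) ^ S.card

/-- The lattice box of (integer) radius `R` about `c`, as a finset. -/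
def boxF {d : ℕ} (c : Site d) (R : ℤ) : Finset (Site d) :=
  Fintype.piFinset fun i => Finset.Icc (c i - R) (c i + R)

/-- The block `Λ_k(j)` as a finset. -/
def LambdaF {d : ℕ} (d₀ α : ℝ) (k : ℕ) (j : Site d) : Finset (Site d) :=
  boxF j (2 * ⌊3 * nscale d₀ α k⌋)

/-- `Λ̄_k(j)`, the `(d_{k+1}/10)`-neighborhood of `Λ_k(j)`, as a finset. -/
def barLambdaF {d : ℕ} (d₀ α : ℝ) (k : ℕ) (j : Site d) : Finset (Site d) :=
  boxF j (2 * ⌊3 * nscale d₀ α k⌋ + ⌊nscale d₀ α (k + 1) / 10⌋)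

/-- The Dirichlet restriction `H_Λ = R_Λ H(ω) R_Λ` of `H(ω) = 2d - Δ + V_hi + βω`,
as a matrix indexed by `Λ`: its entries are `2d + V_hi(x) + βω(x)` on the diagonal and
`-1` between nearest neighbors. -/
def HMat {d : ℕ} (Vhi : Site d → ℝ) (β : ℝ) (ω : Site d → Bool) (Λ : Finset (Site d)) :
    Matrix Λ Λ ℝ := fun x y =>
  (if x = y then 2 * d + Vhi (x : Site d) + β * (if ω (x : Site d) then 1 else 0) else 0)
  - (if l1dist (x : Site d) (y : Site d) = 1 then 1 else 0)

open Matrix in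
/-- A real symmetric matrix has an orthonormal eigenbasis, phrased with `dotProduct`. -/
lemma exists_eigenbasis {n : Type*} [Fintype n] [DecidableEq n] {A : Matrix n n ℝ}
    (hA : A.IsHermitian) :
    ∃ φ : n → n → ℝ, (∀ i j, φ i ⬝ᵥ φ j = if i = j then 1 else 0) ∧
      (∀ i, A *ᵥ φ i = hA.eigenvalues i • φ i) ∧
      ∀ v : n → ℝ, v = ∑ i, (φ i ⬝ᵥ v) • φ i := by
  refine ⟨fun i => (hA.eigenvectorBasis i).ofLp, fun i j => ?_, fun i => ?_, fun v => ?_⟩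
  · have h := orthonormal_iff_ite.mp hA.eigenvectorBasis.orthonormal j i
    rw [EuclideanSpace.inner_eq_star_dotProduct] at h
    simpa [eq_comm] using h
  · exact hA.mulVec_eigenvectorBasis i
  · have h := hA.eigenvectorBasis.sum_repr' (WithLp.toLp 2 v)
    have h2 := congrArg WithLp.ofLp h
    simp only [WithLp.ofLp_sum, WithLp.ofLp_smul, EuclideanSpace.inner_eq_star_dotProduct] at h2
    refine h2.symm.trans (Finset.sum_congr rfl fun i _ => ?_)
    rw [dotProduct_comm]
    simp

open Matrix in
lemma orthonormal_dotProduct_sum {n : Type*} [Fintype n] [DecidableEq n] {φ : n → n → ℝ}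
    (ho : ∀ i j, φ i ⬝ᵥ φ j = if i = j then 1 else 0) (c : n → ℝ) (i : n) :
    φ i ⬝ᵥ ∑ j, c j • φ j = c i := by
  simp [dotProduct_sum, ho]

open Matrix in
lemma eigenbasis_dotProduct_self {n : Type*} [Fintype n] [DecidableEq n] {φ : n → n → ℝ}
    (ho : ∀ i j, φ i ⬝ᵥ φ j = if i = j then 1 else 0) (c : n → ℝ) :
    (∑ j, c j • φ j) ⬝ᵥ (∑ j, c j • φ j) = ∑ i, c i ^ 2 := by
  rw [sum_dotProduct]
  refine Finset.sum_congr rfl fun i _ => ?_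
  rw [smul_dotProduct, orthonormal_dotProduct_sum ho, smul_eq_mul, sq]

open Matrix in
lemma eigenbasis_quadForm {n : Type*} [Fintype n] [DecidableEq n] {A : Matrix n n ℝ}
    {φ : n → n → ℝ} {e : n → ℝ} (ho : ∀ i j, φ i ⬝ᵥ φ j = if i = j then 1 else 0)
    (he : ∀ i, A *ᵥ φ i = e i • φ i) (c : n → ℝ) :
    (∑ j, c j • φ j) ⬝ᵥ A *ᵥ (∑ j, c j • φ j) = ∑ i, e i * c i ^ 2 := by
  have h : A *ᵥ (∑ j, c j • φ j) = ∑ j, (c j * e j) • φ j := by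
    rw [mulVec_sum]
    exact Finset.sum_congr rfl fun j _ => by rw [mulVec_smul, he, smul_smul]
  rw [h, sum_dotProduct]
  refine Finset.sum_congr rfl fun i _ => ?_
  rw [smul_dotProduct, orthonormal_dotProduct_sum ho, smul_eq_mul]
  ring

/-- The number of eigenvalues below `z` (for `σ = 1`) or above `z` (for `σ = -1`). -/
def eigCount {n : Type*} [Fintype n] [DecidableEq n] {A : Matrix n n ℝ}
    (hA : A.IsHermitian) (σ z : ℝ) : ℕ :=
  (Finset.univ.filter fun i => σ * hA.eigenvalues i < σ * z).card

open Matrix in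
lemma card_le_eigCount {n κ : Type*} [Fintype n] [DecidableEq n] [Fintype κ]
    {A : Matrix n n ℝ} (hA : A.IsHermitian) (σ z : ℝ) (f : (κ → ℝ) →ₗ[ℝ] (n → ℝ))
    (hf : ∀ c, c ≠ 0 → σ * (f c ⬝ᵥ A *ᵥ f c) < σ * z * (f c ⬝ᵥ f c)) :
    Fintype.card κ ≤ eigCount hA σ z := by
  classical
  obtain ⟨φ, ho, he, hx⟩ := exists_eigenbasis hA
  let g : (κ → ℝ) →ₗ[ℝ] ({i // σ * hA.eigenvalues i < σ * z} → ℝ) :=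
    { toFun := fun c i => φ i ⬝ᵥ f c
      map_add' := fun c c' => by ext i; simp [dotProduct_add]
      map_smul' := fun r c => by ext i; simp [dotProduct_smul] }
  have hg : Function.Injective g := by
    refine (injective_iff_map_eq_zero g).mpr fun c hc => ?_
    by_contra hne
    have h := hf c hne
    set v := f c with hv
    have h1 : v ⬝ᵥ v = ∑ i, (φ i ⬝ᵥ v) ^ 2 := by
      conv_lhs => rw [hx v]
      exact eigenbasis_dotProduct_self ho _
    have h2 : v ⬝ᵥ A *ᵥ v = ∑ i, hA.eigenvalues i * (φ i ⬝ᵥ v) ^ 2 := by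
      conv_lhs => rw [hx v]
      exact eigenbasis_quadForm ho he _
    rw [h1, h2, Finset.mul_sum, Finset.mul_sum] at h
    refine absurd h (not_lt.mpr (Finset.sum_le_sum fun i _ => ?_))
    by_cases hi : σ * hA.eigenvalues i < σ * z
    · have : φ i ⬝ᵥ v = 0 := congrFun hc ⟨i, hi⟩
      simp [this]
    · nlinarith [sq_nonneg (φ i ⬝ᵥ v), not_lt.mp hi]
  have h := LinearMap.finrank_le_finrank_of_injective hg
  rw [Module.finrank_fintype_fun_eq_card, Module.finrank_fintype_fun_eq_card,
    Fintype.card_subtype] at h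
  exact h

/-- The linear combination of the vectors `φ i` with `i` in a subtype. -/
def subComb {n : Type*} [Fintype n] (φ : n → n → ℝ) (p : n → Prop) [DecidablePred p] :
    ({i // p i} → ℝ) →ₗ[ℝ] (n → ℝ) where
  toFun c := ∑ i, (if h : p i then c ⟨i, h⟩ else 0) • φ i
  map_add' c c' := by
    rw [← Finset.sum_add_distrib]
    refine Finset.sum_congr rfl fun i _ => ?_
    by_cases h : p i <;> simp [h, add_smul]
  map_smul' r c := by
    rw [RingHom.id_apply, Finset.smul_sum]
    refine Finset.sum_congr rfl fun i _ => ?_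
    by_cases h : p i <;> simp [h, smul_smul]

open Matrix in
/-- Eigenvalue counts are monotone in the quadratic form. -/
lemma eigCount_mono {n : Type*} [Fintype n] [DecidableEq n]
    {A B : Matrix n n ℝ} (hA : A.IsHermitian) (hB : B.IsHermitian) (σ z : ℝ)
    (hAB : ∀ v, σ * (v ⬝ᵥ B *ᵥ v) ≤ σ * (v ⬝ᵥ A *ᵥ v)) :
    eigCount hA σ z ≤ eigCount hB σ z := by
  classical
  obtain ⟨φ, ho, he, hx⟩ := exists_eigenbasis hA
  have := card_le_eigCount hB σ z (subComb φ fun i => σ * hA.eigenvalues i < σ * z) ?_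
  · rwa [Fintype.card_subtype] at this
  intro c hc
  refine lt_of_le_of_lt (hAB _) ?_
  simp only [subComb, LinearMap.coe_mk, AddHom.coe_mk]
  rw [eigenbasis_dotProduct_self ho, eigenbasis_quadForm ho he, Finset.mul_sum, Finset.mul_sum]
  obtain ⟨i₀, hi₀⟩ := Function.ne_iff.mp hc
  refine Finset.sum_lt_sum (fun i _ => ?_) ⟨i₀, Finset.mem_univ _, ?_⟩
  · by_cases h : σ * hA.eigenvalues i < σ * z
    · simp only [h, dif_pos]; nlinarith [sq_nonneg (c ⟨i, h⟩)]
    · simp [h]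
  · have h := i₀.2
    simp only [h, dif_pos]
    have : 0 < c i₀ ^ 2 := by have : c i₀ ≠ 0 := hi₀; positivity
    nlinarith

open Matrix in
/-- A rank-one perturbation at a site where an eigenvector is large changes an eigenvalue count,
provided there is a spectral gap of size `g` next to the threshold `z`. -/
lemma eigCount_lt_of_rankOne {n : Type*} [Fintype n] [DecidableEq n]
    {A B : Matrix n n ℝ} (hA : A.IsHermitian) (hB : B.IsHermitian) (σ z g β : ℝ) (y : n)
    (hg : 0 < g) (hβ : 0 < β)
    (hAB : ∀ v, σ * (v ⬝ᵥ B *ᵥ v) = σ * (v ⬝ᵥ A *ᵥ v) - β * v y ^ 2)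
    (hgap : ∀ i, σ * hA.eigenvalues i < σ * z → σ * hA.eigenvalues i ≤ σ * z - g)
    {φ : n → n → ℝ} (ho : ∀ i j, φ i ⬝ᵥ φ j = if i = j then 1 else 0)
    (he : ∀ i, A *ᵥ φ i = hA.eigenvalues i • φ i) (i₀ : n)
    (hi₀ : σ * z ≤ σ * hA.eigenvalues i₀)
    (hy : (σ * hA.eigenvalues i₀ - σ * z) * (g + β) < g * β * φ i₀ y ^ 2) :
    eigCount hA σ z + 1 ≤ eigCount hB σ z := by
  classical
  set p : n → Prop := fun i => σ * hA.eigenvalues i < σ * z ∨ i = i₀ with hp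
  have hcard : Fintype.card {i // p i} = eigCount hA σ z + 1 := by
    rw [Fintype.card_subtype, eigCount, Finset.filter_or, Finset.filter_eq', if_pos (by simp),
      Finset.card_union_of_disjoint, Finset.card_singleton]
    simpa using hi₀
  rw [← hcard]
  refine card_le_eigCount hB σ z (subComb φ p) fun c hc => ?_
  rw [hAB]
  simp only [subComb, LinearMap.coe_mk, AddHom.coe_mk]
  set k : n → ℝ := fun i => if h : p i then c ⟨i, h⟩ else 0 with hk
  change σ * ((∑ i, k i • φ i) ⬝ᵥ A *ᵥ (∑ i, k i • φ i)) - β * (∑ i, k i • φ i) y ^ 2 <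
    σ * z * ((∑ i, k i • φ i) ⬝ᵥ (∑ i, k i • φ i))
  set k' : n → ℝ := fun i => if i = i₀ then 0 else k i with hk'
  set x : n → ℝ := ∑ i, k' i • φ i with hxdef
  have hsplit : (∑ i, k i • φ i) y = k i₀ * φ i₀ y + x y := by
    have : ∀ i, k i • φ i = (if i = i₀ then k i • φ i else 0) + k' i • φ i := by
      intro i; by_cases h : i = i₀ <;> simp [hk', h]
    rw [Finset.sum_congr rfl fun i _ => this i, Finset.sum_add_distrib]
    simp [hxdef]
  have hxx : x y ^ 2 ≤ ∑ i, k' i ^ 2 := by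
    rw [← eigenbasis_dotProduct_self ho k', ← hxdef]
    rw [dotProduct, sq]
    exact Finset.single_le_sum (f := fun i => x i * x i) (fun i _ => mul_self_nonneg _)
      (Finset.mem_univ y)
  rw [eigenbasis_dotProduct_self ho, eigenbasis_quadForm ho he, hsplit]
  have hsum : ∀ w : n → ℝ, ∑ i, w i * k i ^ 2 = w i₀ * k i₀ ^ 2 + ∑ i, w i * k' i ^ 2 := by
    intro w
    have : ∀ i, w i * k i ^ 2 = (if i = i₀ then w i * k i ^ 2 else 0) + w i * k' i ^ 2 := by
      intro i; by_cases h : i = i₀ <;> simp [hk', h]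
    rw [Finset.sum_congr rfl fun i _ => this i, Finset.sum_add_distrib]
    simp
  have h1 := hsum fun i => hA.eigenvalues i
  have h2 := hsum fun _ => 1
  simp only [one_mul] at h2
  rw [h1, h2]
  have h3 : σ * ∑ i, hA.eigenvalues i * k' i ^ 2 ≤ (σ * z - g) * ∑ i, k' i ^ 2 := by
    rw [Finset.mul_sum, Finset.mul_sum]
    refine Finset.sum_le_sum fun i _ => ?_
    by_cases h : i = i₀
    · simp [hk', h]
    · by_cases hz : σ * hA.eigenvalues i < σ * z
      · have := hgap i hz
        nlinarith [sq_nonneg (k' i)]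
      · simp [hk', hk, hp, h, hz]
  set X := ∑ i, k' i ^ 2 with hX
  have hX0 : 0 ≤ X := Finset.sum_nonneg fun i _ => sq_nonneg _
  set t := φ i₀ y
  set s := k i₀
  set l := σ * hA.eigenvalues i₀
  suffices hs : s ^ 2 * (l - σ * z) < g * X + β * (s * t + x y) ^ 2 by
    have e : σ * (hA.eigenvalues i₀ * s ^ 2 + ∑ i, hA.eigenvalues i * k' i ^ 2) =
      l * s ^ 2 + σ * ∑ i, hA.eigenvalues i * k' i ^ 2 := by ring
    nlinarith
  by_cases hs : s = 0
  · have hXpos : 0 < X := by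
      obtain ⟨i₁, hi₁⟩ := Function.ne_iff.mp hc
      have hne : k i₁ ≠ 0 := by
        simp only [hk, i₁.2, dif_pos]; exact hi₁
      have hne' : (i₁ : n) ≠ i₀ := fun h => hne (h ▸ hs)
      have : 0 < k' i₁ ^ 2 := by simp only [hk', hne', if_false]; positivity
      exact lt_of_lt_of_le this (Finset.single_le_sum (f := fun i => k' i ^ 2)
        (fun i _ => sq_nonneg _) (Finset.mem_univ (i₁ : n)))
    rw [hs]
    have := mul_pos hg hXpos
    nlinarith [mul_nonneg hβ.le (sq_nonneg (0 * t + x y))]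
  · have hs2 : 0 < s ^ 2 := by positivity
    have key : (g + β) * (g * x y ^ 2 + β * (s * t + x y) ^ 2) - g * β * (s * t) ^ 2 =
      (β * (s * t) + (g + β) * x y) ^ 2 := by ring
    have hgb : 0 < g + β := by linarith
    have h4 : (g + β) * (s ^ 2 * (l - σ * z)) <
        (g + β) * (g * X + β * (s * t + x y) ^ 2) := by
      have h5 := mul_lt_mul_of_pos_left hy hs2
      have h6 := mul_le_mul_of_nonneg_left hxx hg.le
      have h7 := mul_le_mul_of_nonneg_left h6 hgb.le
      nlinarith [sq_nonneg (β * (s * t) + (g + β) * x y)]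
    exact lt_of_mul_lt_mul_left h4 hgb.le

/-- Leverage scores: on a finite-dimensional function space, point evaluations are controlled by
weights whose total mass is the dimension. -/
lemma exists_leverage {n : Type*} [Fintype n] (K : Submodule ℝ (n → ℝ)) :
    ∃ p : n → ℝ, (∀ y, 0 ≤ p y) ∧ ∑ y, p y = Module.finrank ℝ K ∧
      ∀ b ∈ K, ∀ y, b y ^ 2 ≤ p y * ∑ x, b x ^ 2 := by
  classical
  let L := (WithLp.linearEquiv 2 ℝ (n → ℝ)).symm
  let K' : Submodule ℝ (EuclideanSpace ℝ n) := K.map (L : (n → ℝ) →ₗ[ℝ] EuclideanSpace ℝ n)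
  let φ := stdOrthonormalBasis ℝ K'
  have hfin : Module.finrank ℝ K' = Module.finrank ℝ K := LinearEquiv.finrank_map_eq L K
  refine ⟨fun y => ∑ i, (φ i : EuclideanSpace ℝ n) y ^ 2,
    fun y => Finset.sum_nonneg fun i _ => sq_nonneg _, ?_, fun b hb y => ?_⟩
  · rw [Finset.sum_comm]
    have : ∀ i, ∑ y, (φ i : EuclideanSpace ℝ n) y ^ 2 = 1 := by
      intro i
      have h := φ.orthonormal.1 i
      have h2 : ‖(φ i : EuclideanSpace ℝ n)‖ = 1 := h
      rw [← EuclideanSpace.real_norm_sq_eq, h2, one_pow]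
    simp [this, hfin]
  · have hb' : L b ∈ K' := Submodule.mem_map_of_mem hb
    have h1 := φ.sum_repr ⟨L b, hb'⟩
    have h2 : b y = ∑ i, φ.repr ⟨L b, hb'⟩ i * (φ i : EuclideanSpace ℝ n) y := by
      have := congrArg (fun v : K' => (v : EuclideanSpace ℝ n) y) h1
      simp only [AddSubmonoidClass.coe_finsetSum, SetLike.val_smul] at this
      simpa [L] using this.symm
    have h3 : ∑ x, b x ^ 2 = ∑ i, φ.repr ⟨L b, hb'⟩ i ^ 2 := by
      have h4 : ‖φ.repr ⟨L b, hb'⟩‖ = ‖(⟨L b, hb'⟩ : K')‖ := φ.repr.norm_map _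
      have h5 : ‖(⟨L b, hb'⟩ : K')‖ = ‖L b‖ := rfl
      have e1 := EuclideanSpace.real_norm_sq_eq (φ.repr ⟨L b, hb'⟩)
      have e2 := EuclideanSpace.real_norm_sq_eq (L b)
      rw [h4, h5] at e1
      exact e2.symm.trans e1
    rw [h2, h3, mul_comm]
    exact Finset.sum_mul_sq_le_sq_mul_sq _ _ _

/-- A choice of leverage scores. -/
def leverage {n : Type*} [Fintype n] (K : Submodule ℝ (n → ℝ)) : n → ℝ :=
  (exists_leverage K).choose

lemma leverage_nonneg {n : Type*} [Fintype n] (K : Submodule ℝ (n → ℝ)) (y : n) :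
    0 ≤ leverage K y := (exists_leverage K).choose_spec.1 y

lemma sum_leverage {n : Type*} [Fintype n] (K : Submodule ℝ (n → ℝ)) :
    ∑ y, leverage K y = Module.finrank ℝ K := (exists_leverage K).choose_spec.2.1

lemma sq_le_leverage {n : Type*} [Fintype n] {K : Submodule ℝ (n → ℝ)} {b : n → ℝ} (hb : b ∈ K)
    (y : n) : b y ^ 2 ≤ leverage K y * ∑ x, b x ^ 2 := (exists_leverage K).choose_spec.2.2 b hb y

/-- The sign `±1` attached to a bit. -/
def bitSign (b : Bool) : ℝ := if b then -1 else 1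

/-- Flipping the bit at `y`. -/
def flipAt {n : Type*} [DecidableEq n] (y : n) (ω : n → Bool) : n → Bool :=
  Function.update ω y (!ω y)

lemma flipAt_involutive {n : Type*} [DecidableEq n] (y : n) :
    Function.Involutive (flipAt y : (n → Bool) → n → Bool) := by
  intro ω; simp [flipAt]

lemma sum_flipAt {n : Type*} [Fintype n] [DecidableEq n] (y : n) (f : (n → Bool) → ℝ) :
    ∑ ω, f (flipAt y ω) = ∑ ω, f ω :=
  Equiv.sum_comp (flipAt_involutive y).toPerm f

lemma flipAt_apply_self {n : Type*} [DecidableEq n] (y : n) (ω : n → Bool) :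
    flipAt y ω y = !ω y := by simp [flipAt]

lemma flipAt_apply_of_ne {n : Type*} [DecidableEq n] {x y : n} (h : x ≠ y) (ω : n → Bool) :
    flipAt y ω x = ω x := by simp [flipAt, h]

lemma bitSign_not (b : Bool) : bitSign (!b) = -bitSign b := by cases b <;> simp [bitSign]

lemma bitSign_mul_self (b : Bool) : bitSign b * bitSign b = 1 := by cases b <;> simp [bitSign]

/-- An `L²` bound for sums of signs with predictable weights. -/
lemma sum_sq_predictable {n : Type*} [Fintype n] [DecidableEq n] (ℓ : n → ℕ)
    (w : n → (n → Bool) → ℝ)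
    (hw : ∀ y ω ω', (∀ x, ℓ x < ℓ y → ω x = ω' x) → w y ω = w y ω') :
    ∑ ω, (∑ y, w y ω * bitSign (ω y)) ^ 2 = ∑ ω, ∑ y, w y ω ^ 2 := by
  have hflip : ∀ x y ω, ℓ y ≤ ℓ x → w y (flipAt x ω) = w y ω := fun x y ω h =>
    hw y _ _ fun z hz => flipAt_apply_of_ne (fun e => by subst e; omega) ω
  have hcross : ∀ x y, x ≠ y → ℓ y ≤ ℓ x →
      ∑ ω, w x ω * bitSign (ω x) * (w y ω * bitSign (ω y)) = 0 := by
    intro x y hxy hl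
    have h := sum_flipAt x fun ω => w x ω * bitSign (ω x) * (w y ω * bitSign (ω y))
    simp only [hflip x x _ le_rfl, hflip x y _ hl, flipAt_apply_self, bitSign_not,
      flipAt_apply_of_ne hxy.symm] at h
    have h2 : ∀ ω : n → Bool, w x ω * -bitSign (ω x) * (w y ω * bitSign (ω y)) =
      -(w x ω * bitSign (ω x) * (w y ω * bitSign (ω y))) := fun ω => by ring
    rw [Finset.sum_congr rfl fun ω _ => h2 ω, Finset.sum_neg_distrib] at h
    linarith
  have hcross' : ∀ x y, x ≠ y →
      ∑ ω, w x ω * bitSign (ω x) * (w y ω * bitSign (ω y)) = 0 := by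
    intro x y hxy
    rcases le_total (ℓ y) (ℓ x) with h | h
    · exact hcross x y hxy h
    · rw [← hcross y x hxy.symm h]
      exact Finset.sum_congr rfl fun ω _ => mul_comm _ _
  simp only [sq, Finset.sum_mul_sum]
  rw [Finset.sum_comm, Finset.sum_comm (s := Finset.univ) (t := Finset.univ)
    (f := fun ω y => w y ω * w y ω)]
  refine Finset.sum_congr rfl fun x _ => ?_
  rw [Finset.sum_comm, Finset.sum_eq_single x (fun y _ hy => hcross' x y hy.symm) (by simp)]
  refine Finset.sum_congr rfl fun ω _ => ?_
  have := bitSign_mul_self (ω x)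
  linear_combination (w x ω * w x ω) * this

/-- A bounded function that is antitone in every bit, and drops by at least one across the edges
at `ω` in the directions `y ∈ L ω` whenever `ω` is bad, has few bad points provided the directions
`L ω` have large predictable weight. -/
lemma card_bad_le {n : Type*} [Fintype n] [DecidableEq n] (ℓ : n → ℕ)
    (w : n → (n → Bool) → ℝ) (hw0 : ∀ y ω, 0 ≤ w y ω)
    (hw : ∀ y ω ω', (∀ x, ℓ x < ℓ y → ω x = ω' x) → w y ω = w y ω')
    (Φ : (n → Bool) → ℝ) (F T S : ℝ) (hF : ∀ ω, |Φ ω| ≤ F)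
    (hΦ : ∀ ω y, 0 ≤ bitSign (ω y) * (Φ ω - Φ (flipAt y ω)))
    (hS : ∀ ω, ∑ y, w y ω ^ 2 ≤ S)
    (B : Finset (n → Bool)) (L : (n → Bool) → Finset n)
    (hL : ∀ ω ∈ B, T ≤ ∑ y ∈ L ω, w y ω)
    (hdrop : ∀ ω ∈ B, ∀ y ∈ L ω, 1 ≤ bitSign (ω y) * (Φ ω - Φ (flipAt y ω))) :
    B.card * T ≤ 2 * F * √S * 2 ^ Fintype.card n := by
  have hflip : ∀ y ω, w y (flipAt y ω) = w y ω := fun y ω =>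
    hw y _ _ fun z hz => flipAt_apply_of_ne (fun e => by subst e; omega) ω
  have h1 : B.card * T ≤ ∑ ω, ∑ y, w y ω * (bitSign (ω y) * (Φ ω - Φ (flipAt y ω))) := by
    have hnn : ∀ ω y, 0 ≤ w y ω * (bitSign (ω y) * (Φ ω - Φ (flipAt y ω))) :=
      fun ω y => mul_nonneg (hw0 _ _) (hΦ _ _)
    calc B.card * T = ∑ ω ∈ B, T := by simp
      _ ≤ ∑ ω ∈ B, ∑ y, w y ω * (bitSign (ω y) * (Φ ω - Φ (flipAt y ω))) := by
        refine Finset.sum_le_sum fun ω hω => (hL ω hω).trans ?_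
        refine le_trans (Finset.sum_le_sum fun y hy => ?_)
          (Finset.sum_le_sum_of_subset_of_nonneg (Finset.subset_univ (L ω))
            fun y _ _ => hnn ω y)
        exact le_mul_of_one_le_right (hw0 _ _) (hdrop ω hω y hy)
      _ ≤ _ := Finset.sum_le_sum_of_subset_of_nonneg (Finset.subset_univ B)
            fun ω _ _ => Finset.sum_nonneg fun y _ => hnn ω y
  have h2 : ∑ ω, ∑ y, w y ω * (bitSign (ω y) * (Φ ω - Φ (flipAt y ω))) =
      2 * ∑ ω, (∑ y, w y ω * bitSign (ω y)) * Φ ω := by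
    rw [Finset.sum_comm]
    simp only [Finset.sum_mul]
    rw [Finset.sum_comm (f := fun ω y => w y ω * bitSign (ω y) * Φ ω), Finset.mul_sum]
    refine Finset.sum_congr rfl fun y _ => ?_
    have h := sum_flipAt y fun ω => w y ω * bitSign (ω y) * Φ ω
    simp only [hflip, flipAt_apply_self, bitSign_not] at h
    rw [two_mul]
    nth_rewrite 2 [← h]
    rw [← Finset.sum_add_distrib]
    exact Finset.sum_congr rfl fun ω _ => by ring
  have hF0 : 0 ≤ F := (abs_nonneg _).trans (hF fun _ => false)
  set Y : (n → Bool) → ℝ := fun ω => ∑ y, w y ω * bitSign (ω y) with hY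
  have h3 : ∑ ω, Y ω * Φ ω ≤ F * ∑ ω, |Y ω| := by
    rw [Finset.mul_sum]
    refine Finset.sum_le_sum fun ω _ => (le_abs_self _).trans ?_
    rw [abs_mul, mul_comm]
    exact mul_le_mul_of_nonneg_right (hF ω) (abs_nonneg _)
  have hcard : ((Finset.univ : Finset (n → Bool)).card : ℝ) = 2 ^ Fintype.card n := by
    simp
  have h4 : (∑ ω, |Y ω|) ^ 2 ≤ 2 ^ Fintype.card n * (2 ^ Fintype.card n * S) := by
    refine (sq_sum_le_card_mul_sum_sq).trans ?_
    rw [hcard]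
    refine mul_le_mul_of_nonneg_left ?_ (by positivity)
    simp only [sq_abs]
    rw [hY, sum_sq_predictable ℓ w hw]
    refine (Finset.sum_le_sum fun ω _ => hS ω).trans ?_
    rw [Finset.sum_const, nsmul_eq_mul, hcard]
  have h5 : ∑ ω, |Y ω| ≤ √S * 2 ^ Fintype.card n := by
    have hp : (0 : ℝ) ≤ 2 ^ Fintype.card n := by positivity
    have := Real.le_sqrt_of_sq_le h4
    rwa [← mul_assoc, Real.sqrt_mul (by positivity), Real.sqrt_mul_self hp, mul_comm] at this
  calc (B.card : ℝ) * T ≤ 2 * ∑ ω, Y ω * Φ ω := h1.trans h2.le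
    _ ≤ 2 * (F * (√S * 2 ^ Fintype.card n)) := by
      have := mul_le_mul_of_nonneg_left h5 hF0
      linarith
    _ = _ := by ring

/-- A discrete Schrödinger operator with hopping matrix `a`, potential `V` and Bernoulli
disorder `β ω`. -/
def ham {n : Type*} [DecidableEq n] (a : Matrix n n ℝ) (V : n → ℝ) (β : ℝ) (ω : n → Bool) :
    Matrix n n ℝ :=
  Matrix.diagonal (fun x => V x + β * (if ω x then 1 else 0)) - a

open Matrix in
lemma ham_mulVec {n : Type*} [Fintype n] [DecidableEq n] (a : Matrix n n ℝ) (V : n → ℝ) (β : ℝ)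
    (ω : n → Bool) (u : n → ℝ) (x : n) :
    (ham a V β ω *ᵥ u) x = (V x + β * (if ω x then 1 else 0)) * u x - ∑ z, a x z * u z := by
  rw [ham, sub_mulVec, Pi.sub_apply, mulVec_diagonal]; rfl

lemma ham_isHermitian {n : Type*} [DecidableEq n] {a : Matrix n n ℝ}
    (ha : ∀ x y, a x y = a y x) (V : n → ℝ) (β : ℝ) (ω : n → Bool) :
    (ham a V β ω).IsHermitian := by
  refine Matrix.IsHermitian.ext fun x y => ?_
  by_cases h : x = y
  · subst h; simp
  · simp [ham, Matrix.diagonal_apply_ne _ h, Matrix.diagonal_apply_ne _ (Ne.symm h), ha x y]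

lemma sum_hopping_le {n : Type*} [Fintype n] {a : Matrix n n ℝ} {D : ℝ}
    (ha : ∀ x y, a x y = a y x) (ha0 : ∀ x y, 0 ≤ a x y) (haD : ∀ x, ∑ y, a x y ≤ D)
    (v : n → ℝ) : ∑ x, ∑ y, a x y * (v x * v y) ≤ D * ∑ x, v x ^ 2 := by
  have h1 : ∑ x, ∑ y, a x y * (v x * v y) ≤
      ∑ x, ∑ y, (a x y * v x ^ 2 + a x y * v y ^ 2) / 2 :=
    Finset.sum_le_sum fun x _ => Finset.sum_le_sum fun y _ => by
      nlinarith [mul_nonneg (ha0 x y) (sq_nonneg (v x - v y))]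
  have h2 : ∑ x, ∑ y, a x y * v x ^ 2 ≤ D * ∑ x, v x ^ 2 := by
    rw [Finset.mul_sum]
    refine Finset.sum_le_sum fun x _ => ?_
    rw [← Finset.sum_mul]
    exact mul_le_mul_of_nonneg_right (haD x) (sq_nonneg _)
  have h3 : ∑ x, ∑ y, a x y * v y ^ 2 = ∑ x, ∑ y, a x y * v x ^ 2 := by
    rw [Finset.sum_comm]
    exact Finset.sum_congr rfl fun x _ => Finset.sum_congr rfl fun y _ => by rw [ha]
  simp only [← Finset.sum_div, Finset.sum_add_distrib] at h1
  linarith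

open Matrix in
/-- The operator is bounded below by `h` on functions supported in the barrier. -/
lemma le_quadForm_ham {n : Type*} [Fintype n] [DecidableEq n] {a : Matrix n n ℝ} {D h β : ℝ}
    (ha : ∀ x y, a x y = a y x) (ha0 : ∀ x y, 0 ≤ a x y) (haD : ∀ x, ∑ y, a x y ≤ D)
    {V : n → ℝ} {W : Finset n} (hV : ∀ x, x ∉ W → D + h ≤ V x) (hβ : 0 ≤ β)
    (ω : n → Bool) {v : n → ℝ} (hv : ∀ x ∈ W, v x = 0) :
    h * ∑ x, v x ^ 2 ≤ v ⬝ᵥ ham a V β ω *ᵥ v := by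
  have h1 := sum_hopping_le ha ha0 haD v
  have h2 : v ⬝ᵥ ham a V β ω *ᵥ v =
      ∑ x, (V x + β * (if ω x then 1 else 0)) * v x ^ 2 - ∑ x, ∑ y, a x y * (v x * v y) := by
    simp only [dotProduct, ham_mulVec]
    rw [← Finset.sum_sub_distrib]
    refine Finset.sum_congr rfl fun x _ => ?_
    rw [mul_sub, Finset.mul_sum]
    congr 1
    · ring
    · exact Finset.sum_congr rfl fun y _ => by ring
  have h3 : (D + h) * ∑ x, v x ^ 2 ≤ ∑ x, (V x + β * (if ω x then 1 else 0)) * v x ^ 2 := by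
    rw [Finset.mul_sum]
    refine Finset.sum_le_sum fun x _ => ?_
    by_cases hx : x ∈ W
    · simp [hv x hx]
    · refine mul_le_mul_of_nonneg_right ?_ (sq_nonneg _)
      have : (0 : ℝ) ≤ β * (if ω x then 1 else 0) := by positivity
      linarith [hV x hx]
  rw [h2]; linarith

open Matrix in
/-- An `ℓ²` bound for `(H - E) v`. -/
lemma sum_sq_ham_sub_le {n : Type*} [Fintype n] [DecidableEq n] {a : Matrix n n ℝ} {D Q β E : ℝ}
    (ha : ∀ x y, a x y = a y x) (ha0 : ∀ x y, 0 ≤ a x y) (haD : ∀ x, ∑ y, a x y ≤ D)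
    (hD : 0 ≤ D) {V : n → ℝ} (hβ : 0 ≤ β) (hQ : ∀ x, |V x| + β + |E| + 1 + D ≤ Q)
    (ω : n → Bool) (v : n → ℝ) :
    ∑ x, ((ham a V β ω *ᵥ v) x - E * v x) ^ 2 ≤ Q ^ 2 * ∑ x, v x ^ 2 := by
  rcases isEmpty_or_nonempty n with hn | ⟨⟨x₀⟩⟩
  · simp
  have hQD : D ≤ Q := by linarith [hQ x₀, abs_nonneg (V x₀), abs_nonneg E]
  have hpt : ∀ x, ((ham a V β ω *ᵥ v) x - E * v x) ^ 2 ≤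
      Q * ((Q - D) * v x ^ 2 + ∑ z, a x z * v z ^ 2) := by
    intro x
    set k := V x + β * (if ω x then 1 else 0) - E with hk
    have hkQ : |k| ≤ Q - D := by
      have h1 : |k| ≤ |V x| + β + |E| := by
        rw [hk]
        refine (abs_sub _ _).trans ?_
        refine add_le_add ((abs_add_le _ _).trans (add_le_add le_rfl ?_)) le_rfl
        split_ifs <;> simp [abs_of_nonneg hβ, hβ]
      linarith [hQ x]
    have h0 : 0 ≤ Q - D := (abs_nonneg k).trans hkQ
    have e : (ham a V β ω *ᵥ v) x - E * v x = k * v x - ∑ z, a x z * v z := by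
      rw [ham_mulVec, hk]; ring
    rw [e]
    set s := ∑ z, a x z * v z with hs
    have hs2 : s ^ 2 ≤ D * ∑ z, a x z * v z ^ 2 := by
      have hcs := Finset.sum_sq_le_sum_mul_sum_of_sq_le_mul Finset.univ
        (r := fun z => a x z * v z) (f := fun z => a x z) (g := fun z => a x z * v z ^ 2)
        (fun z _ => ha0 x z) (fun z _ => mul_nonneg (ha0 x z) (sq_nonneg _))
        (fun z _ => le_of_eq (by ring))
      exact hcs.trans (mul_le_mul_of_nonneg_right (haD x)
        (Finset.sum_nonneg fun z _ => mul_nonneg (ha0 x z) (sq_nonneg _)))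
    set t := ∑ z, a x z * v z ^ 2
    have ht : 0 ≤ t := Finset.sum_nonneg fun z _ => mul_nonneg (ha0 x z) (sq_nonneg _)
    set P := Q - D with hP
    have hk2 : k ^ 2 ≤ P ^ 2 := sq_le_sq' (by linarith [neg_abs_le k]) ((le_abs_self k).trans hkQ)
    have hQe : Q = P + D := by rw [hP]; ring
    have hP1 : 1 ≤ P := by
      linarith [hQ x, abs_nonneg (V x), abs_nonneg E]
    have h5 : P * (k * v x - s) ^ 2 ≤ P * (Q * (P * v x ^ 2 + t)) := by
      rcases hD.eq_or_lt with hD0 | hD0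
      · have : s = 0 := by
          rw [← hD0] at hs2
          nlinarith
        rw [this, hQe, ← hD0]
        have := mul_le_mul_of_nonneg_right hk2 (sq_nonneg (v x))
        have h6 : 0 ≤ P * P * t := by positivity
        nlinarith
      · have h7 : D * (k * v x - s) ^ 2 ≤ D * ((P + D) * (P * v x ^ 2 + t)) := by
          have i1 : (k * v x) ^ 2 ≤ P ^ 2 * v x ^ 2 := by
            rw [mul_pow]; exact mul_le_mul_of_nonneg_right hk2 (sq_nonneg _)
          have i2 : P * (D * (k * v x - s) ^ 2) ≤
              P * (D * ((P + D) * (P * v x ^ 2 + t))) := by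
            have i3 : P * D * (k * v x - s) ^ 2 ≤ (P + D) * (D * (k * v x) ^ 2 + P * s ^ 2) := by
              nlinarith [sq_nonneg (D * (k * v x) + P * s)]
            have i4 : D * (k * v x) ^ 2 + P * s ^ 2 ≤ D * (P ^ 2 * v x ^ 2) + P * (D * t) :=
              add_le_add (mul_le_mul_of_nonneg_left i1 hD) (mul_le_mul_of_nonneg_left hs2 h0)
            have i5 := mul_le_mul_of_nonneg_left i4 (add_nonneg h0 hD)
            nlinarith
          exact le_of_mul_le_mul_left i2 (by linarith)
        rw [hQe]
        exact mul_le_mul_of_nonneg_left (le_of_mul_le_mul_left h7 hD0) h0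
    exact le_of_mul_le_mul_left h5 (by linarith)
  refine (Finset.sum_le_sum fun x _ => hpt x).trans ?_
  have h3 : ∑ x, ∑ z, a x z * v z ^ 2 ≤ D * ∑ x, v x ^ 2 := by
    rw [Finset.sum_comm, Finset.mul_sum]
    refine Finset.sum_le_sum fun z _ => ?_
    rw [← Finset.sum_mul]
    refine mul_le_mul_of_nonneg_right ?_ (sq_nonneg _)
    simpa only [ha] using haD z
  rw [← Finset.mul_sum, Finset.sum_add_distrib, ← Finset.mul_sum]
  have hQ0 : 0 ≤ Q := hD.trans hQD
  have := mul_le_mul_of_nonneg_left h3 hQ0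
  nlinarith

/-- The linear conditions `(H - E) g = 0` in the barrier part of the ball `{ℓ ≤ r}` and `g = 0`
outside of the ball. -/
def innerMap {n : Type*} [Fintype n] [DecidableEq n] (a : Matrix n n ℝ) (V : n → ℝ) (β E : ℝ)
    (W : Finset n) (ℓ : n → ℕ) (r : ℕ) (ω : n → Bool) : (n → ℝ) →ₗ[ℝ] (n → ℝ) where
  toFun g x := if x ∈ W then 0 else
    if ℓ x ≤ r then (ham a V β ω).mulVec g x - E * g x else g x
  map_add' g g' := by
    ext x; simp only [Matrix.mulVec_add, Pi.add_apply]; split_ifs <;> ring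
  map_smul' c g := by
    ext x; simp only [Matrix.mulVec_smul, Pi.smul_apply, smul_eq_mul, RingHom.id_apply]
    split_ifs <;> ring

/-- The flux of `g` through the boundary of the ball `{ℓ ≤ r}`. -/
def fluxMap {n : Type*} [Fintype n] (a : Matrix n n ℝ) (ℓ : n → ℕ) (r : ℕ) :
    (n → ℝ) →ₗ[ℝ] (n → ℝ) where
  toFun g x := if ℓ x ≤ r then 0 else ∑ z, a x z * g z
  map_add' g g' := by
    ext x; simp only [Pi.add_apply, mul_add, Finset.sum_add_distrib]; split_ifs <;> ring
  map_smul' c g := by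
    ext x
    simp only [Pi.smul_apply, smul_eq_mul, RingHom.id_apply]
    split_ifs
    · simp
    · rw [Finset.mul_sum]
      exact Finset.sum_congr rfl fun z _ => by ring

/-- The space of boundary fluxes of solutions in the ball `{ℓ ≤ r}`. -/
def fluxSpace {n : Type*} [Fintype n] [DecidableEq n] (a : Matrix n n ℝ) (V : n → ℝ) (β E : ℝ)
    (W : Finset n) (ℓ : n → ℕ) (r : ℕ) (ω : n → Bool) : Submodule ℝ (n → ℝ) :=
  (LinearMap.ker (innerMap a V β E W ℓ r ω)).map (fluxMap a ℓ r)

lemma fluxSpace_congr {n : Type*} [Fintype n] [DecidableEq n] (a : Matrix n n ℝ) (V : n → ℝ)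
    (β E : ℝ) (W : Finset n) (ℓ : n → ℕ) (r : ℕ) {ω ω' : n → Bool}
    (h : ∀ x, ℓ x ≤ r → ω x = ω' x) :
    fluxSpace a V β E W ℓ r ω = fluxSpace a V β E W ℓ r ω' := by
  have : innerMap a V β E W ℓ r ω = innerMap a V β E W ℓ r ω' := by
    ext1 i; ext x
    simp only [innerMap, LinearMap.coe_comp, LinearMap.coe_mk, AddHom.coe_mk,
      Function.comp_apply, ham_mulVec]
    by_cases hx : ℓ x ≤ r
    · simp only [h x hx]
    · simp only [hx, if_false]
  rw [fluxSpace, fluxSpace, this]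

open Matrix in
/-- Solutions supported in the barrier vanish. -/
lemma eq_zero_of_innerMap {n : Type*} [Fintype n] [DecidableEq n] {a : Matrix n n ℝ}
    {D h β E : ℝ} (ha : ∀ x y, a x y = a y x) (ha0 : ∀ x y, 0 ≤ a x y)
    (haD : ∀ x, ∑ y, a x y ≤ D) {V : n → ℝ} {W : Finset n} (hV : ∀ x, x ∉ W → D + h ≤ V x)
    (hβ : 0 ≤ β) (hE : E < h) (ℓ : n → ℕ) (r : ℕ) (ω : n → Bool) {g : n → ℝ}
    (hg : innerMap a V β E W ℓ r ω g = 0) (hW : ∀ x ∈ W, g x = 0) : g = 0 := by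
  have h1 := le_quadForm_ham ha ha0 haD hV hβ ω hW
  have h2 : g ⬝ᵥ ham a V β ω *ᵥ g = E * ∑ x, g x ^ 2 := by
    rw [dotProduct, Finset.mul_sum]
    refine Finset.sum_congr rfl fun x _ => ?_
    by_cases hx : x ∈ W
    · simp [hW x hx]
    · have h3 := congrFun hg x
      simp only [innerMap, LinearMap.coe_mk, AddHom.coe_mk, hx, if_false, Pi.zero_apply] at h3
      split_ifs at h3 with h4
      · rw [sub_eq_zero.mp h3]; ring
      · simp [h3]
  have h0 : 0 ≤ ∑ x, g x ^ 2 := Finset.sum_nonneg fun x _ => sq_nonneg _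
  have h3 : ∑ x, g x ^ 2 = 0 := by nlinarith
  ext x
  have := (Finset.sum_eq_zero_iff_of_nonneg fun x _ => sq_nonneg (g x)).mp h3 x (Finset.mem_univ x)
  simpa using this

lemma finrank_fluxSpace_le {n : Type*} [Fintype n] [DecidableEq n] {a : Matrix n n ℝ}
    {D h β E : ℝ} (ha : ∀ x y, a x y = a y x) (ha0 : ∀ x y, 0 ≤ a x y)
    (haD : ∀ x, ∑ y, a x y ≤ D) {V : n → ℝ} {W : Finset n} (hV : ∀ x, x ∉ W → D + h ≤ V x)
    (hβ : 0 ≤ β) (hE : E < h) (ℓ : n → ℕ) (r : ℕ) (ω : n → Bool) :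
    Module.finrank ℝ (fluxSpace a V β E W ℓ r ω) ≤ W.card := by
  refine (Submodule.finrank_map_le _ _).trans ?_
  let f : LinearMap.ker (innerMap a V β E W ℓ r ω) →ₗ[ℝ] (W → ℝ) :=
    (LinearMap.funLeft ℝ ℝ (Subtype.val : W → n)).comp (Submodule.subtype _)
  have hf : Function.Injective f := by
    refine (injective_iff_map_eq_zero f).mpr fun g hg => ?_
    have := eq_zero_of_innerMap ha ha0 haD hV hβ hE ℓ r ω (LinearMap.mem_ker.mp g.2)
      (fun x hx => congrFun hg ⟨x, hx⟩)
    exact Subtype.ext this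
  have h := LinearMap.finrank_le_finrank_of_injective hf
  rwa [Module.finrank_fintype_fun_eq_card, Fintype.card_coe] at h

/-- Every profile on the wells extends to a solution in the ball. -/
lemma exists_innerMap_eq_zero {n : Type*} [Fintype n] [DecidableEq n] {a : Matrix n n ℝ}
    {D h β E : ℝ} (ha : ∀ x y, a x y = a y x) (ha0 : ∀ x y, 0 ≤ a x y)
    (haD : ∀ x, ∑ y, a x y ≤ D) {V : n → ℝ} {W : Finset n} (hV : ∀ x, x ∉ W → D + h ≤ V x)
    (hβ : 0 ≤ β) (hE : E < h) (ℓ : n → ℕ) (r : ℕ) (ω : n → Bool) (u : n → ℝ) :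
    ∃ g, innerMap a V β E W ℓ r ω g = 0 ∧ ∀ x ∈ W, g x = u x := by
  let P : (n → ℝ) →ₗ[ℝ] (n → ℝ) :=
    { toFun := fun g x => if x ∈ W then g x else 0
      map_add' := fun g g' => by ext x; simp only [Pi.add_apply]; split_ifs <;> ring
      map_smul' := fun c g => by
        ext x; simp only [Pi.smul_apply, smul_eq_mul, RingHom.id_apply]; split_ifs <;> ring }
  have hval : ∀ g x, (innerMap a V β E W ℓ r ω + P) g x =
      if x ∈ W then g x else innerMap a V β E W ℓ r ω g x := by
    intro g x
    by_cases hx : x ∈ W <;> simp [P, innerMap, hx]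
  have hinj : Function.Injective (innerMap a V β E W ℓ r ω + P) := by
    refine (injective_iff_map_eq_zero _).mpr fun g hg => ?_
    have hW : ∀ x ∈ W, g x = 0 := fun x hx => by
      have := congrFun hg x
      rw [hval, if_pos hx] at this; exact this
    refine eq_zero_of_innerMap ha ha0 haD hV hβ hE ℓ r ω (funext fun x => ?_) hW
    by_cases hx : x ∈ W
    · simp [innerMap, hx]
    · have := congrFun hg x
      rwa [hval, if_neg hx] at this
  obtain ⟨g, hg⟩ := (LinearMap.injective_iff_surjective.mp hinj) (P u)
  refine ⟨g, funext fun x => ?_, fun x hx => ?_⟩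
  · by_cases hx : x ∈ W
    · simp [innerMap, hx]
    · have := congrFun hg x
      rw [hval, if_neg hx] at this
      rw [this]; simp [P, hx]
  · have := congrFun hg x
    rw [hval, if_pos hx] at this
    rw [this]; simp [P, hx]

open Matrix in
/-- Quantitative unique continuation: an eigenfunction is controlled by its values outside of a
ball, by solving the eigenvalue equation layer by layer in a coordinate direction. -/
lemma abs_le_of_layers {n : Type*} [Fintype n] [DecidableEq n] {a : Matrix n n ℝ}
    {D Q β E lam m : ℝ} (ha0 : ∀ x y, 0 ≤ a x y) (haD : ∀ x, ∑ y, a x y ≤ D)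
    {V : n → ℝ} (hβ : 0 ≤ β) (hQ : ∀ x, |V x| + β + |E| + 1 + D ≤ Q) (hD : 0 ≤ D)
    (ω : n → Bool) {ℓ : n → ℕ} {c : n → ℤ} (hc : ∀ x, |c x| ≤ ℓ x) {r : ℕ}
    (hnext : ∀ x, ℓ x ≤ r → ∃ x', a x' x = 1 ∧ c x' = c x + 1 ∧
      ∀ z, a x' z ≠ 0 → z ≠ x → c x + 1 ≤ c z)
    {u : n → ℝ} (hu : ham a V β ω *ᵥ u = lam • u) (hlam : |lam - E| ≤ 1) (hm0 : 0 ≤ m)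
    (hm : ∀ x, r < ℓ x → |u x| ≤ m) (x : n) : |u x| ≤ Q ^ (2 * r + 1) * m := by
  have hQ1 : 1 ≤ Q := by linarith [hQ x, abs_nonneg (V x), abs_nonneg E]
  have key : ∀ s : ℕ, ∀ x, (r : ℤ) + 1 - s ≤ c x → |u x| ≤ Q ^ s * m := by
    intro s
    induction s with
    | zero =>
      intro x hx
      have h1 := (le_abs_self (c x)).trans (hc x)
      simpa using hm x (by push_cast at hx; omega)
    | succ s ih =>
      intro x hx
      have hle : Q ^ s * m ≤ Q ^ (s + 1) * m :=
        mul_le_mul_of_nonneg_right (pow_le_pow_right₀ hQ1 (Nat.le_succ s)) hm0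
      by_cases hr : r < ℓ x
      · exact (hm x hr).trans (le_mul_of_one_le_left hm0 (one_le_pow₀ hQ1))
      obtain ⟨x', h1, h2, h3⟩ := hnext x (not_lt.mp hr)
      have hx' : (r : ℤ) + 1 - s ≤ c x' := by push_cast at hx; omega
      have e := congrFun hu x'
      rw [ham_mulVec, ← Finset.add_sum_erase _ _ (Finset.mem_univ x), h1] at e
      simp only [Pi.smul_apply, smul_eq_mul, one_mul] at e
      set S := ∑ z ∈ Finset.univ.erase x, a x' z * u z with hS
      set k := V x' + β * (if ω x' then 1 else 0) - lam with hk
      have e' : u x = k * u x' - S := by rw [hk]; linarith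
      have hkQ : |k| ≤ Q - D := by
        have i1 : |lam| ≤ |E| + 1 := by
          have := abs_add_le (lam - E) E
          rw [sub_add_cancel] at this; linarith
        have i2 : |k| ≤ |V x'| + β + |lam| := by
          rw [hk]
          refine (abs_sub _ _).trans ?_
          refine add_le_add ((abs_add_le _ _).trans (add_le_add le_rfl ?_)) le_rfl
          split_ifs <;> simp [abs_of_nonneg hβ, hβ]
        linarith [hQ x']
      have hm' : 0 ≤ Q ^ s * m := by positivity
      have hSb : |S| ≤ D * (Q ^ s * m) := by
        refine (Finset.abs_sum_le_sum_abs _ _).trans ?_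
        have i3 : ∀ z ∈ Finset.univ.erase x, |a x' z * u z| ≤ a x' z * (Q ^ s * m) := by
          intro z hz
          rw [abs_mul, abs_of_nonneg (ha0 _ _)]
          by_cases hz0 : a x' z = 0
          · simp [hz0]
          · refine mul_le_mul_of_nonneg_left (ih z ?_) (ha0 _ _)
            have := h3 z hz0 (Finset.ne_of_mem_erase hz)
            push_cast at hx; omega
        refine (Finset.sum_le_sum i3).trans ?_
        rw [← Finset.sum_mul]
        refine mul_le_mul_of_nonneg_right ((Finset.sum_le_sum_of_subset_of_nonneg
          (Finset.erase_subset _ _) fun z _ _ => ha0 _ _).trans (haD x')) hm'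
      have hkb : |k * u x'| ≤ (Q - D) * (Q ^ s * m) := by
        rw [abs_mul]
        exact mul_le_mul hkQ (ih x' hx') (abs_nonneg _) ((abs_nonneg k).trans hkQ)
      rw [e', pow_succ]
      refine (abs_sub _ _).trans ?_
      linarith
  by_cases hr : r < ℓ x
  · exact (hm x hr).trans (le_mul_of_one_le_left hm0 (one_le_pow₀ hQ1))
  · refine key _ x ?_
    have := (neg_abs_le (c x))
    have := hc x
    push_cast; omega

set_option maxHeartbeats 1000000 in
open Matrix in
/-- An eigenfunction is not small on a set of boundary sites carrying a definite amount of the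
leverage of the space of boundary fluxes. -/
lemma le_sum_leverage {n : Type*} [Fintype n] [DecidableEq n] {a : Matrix n n ℝ}
    {D Q h κ β E lam δ θ η : ℝ} (ha : ∀ x y, a x y = a y x)
    (ha0 : ∀ x y, 0 ≤ a x y) (haD : ∀ x, ∑ y, a x y ≤ D) (hD : 0 ≤ D)
    {V : n → ℝ} {W : Finset n} (hV : ∀ x, x ∉ W → D + h ≤ V x) (hβ : 0 ≤ β)
    (hQ : ∀ x, |V x| + β + |E| + 1 + D ≤ Q) (hκ : 0 < κ) (hκQ : κ ≤ Q) (hE : E + κ ≤ h)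
    (ω : n → Bool) {ℓ : n → ℕ} (hℓ : ∀ x z, a x z ≠ 0 → ℓ x ≤ ℓ z + 1)
    {c : n → ℤ} (hc : ∀ x, |c x| ≤ ℓ x) {r : ℕ} (hW : ∀ x ∈ W, ℓ x ≤ r)
    (hnext : ∀ x, ℓ x ≤ r → ∃ x', a x' x = 1 ∧ c x' = c x + 1 ∧
      ∀ z, a x' z ≠ 0 → z ≠ x → c x + 1 ≤ c z)
    {u : n → ℝ} (hu : ham a V β ω *ᵥ u = lam • u) (hu1 : ∑ x, u x ^ 2 = 1)
    (hlam : |lam - E| ≤ δ) (hδ1 : δ ≤ 1) (hθ : 0 < θ)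
    (hθQ : θ ^ 2 * (Fintype.card n * (Q ^ (2 * r + 1)) ^ 2) ≤ 1) (hδ : δ ≤ κ * θ / 2)
    (hη0 : 0 ≤ η) (hη : η * √(Fintype.card n) * (2 * Q) ≤ κ * θ / 4) :
    (κ / (8 * Q)) ^ 2 ≤ ∑ y ∈ Finset.univ.filter fun y => ℓ y = r + 1 ∧ η ≤ |u y|,
      leverage (fluxSpace a V β E W ℓ r ω) y := by
  have hQ0 : 0 < Q := hκ.trans_le hκQ
  obtain ⟨g, hg, hgW⟩ := exists_innerMap_eq_zero ha ha0 haD hV hβ (by linarith : E < h) ℓ r ω u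
  set b := fluxMap a ℓ r g with hb
  set v := u - g with hv
  have hgout : ∀ x, r < ℓ x → g x = 0 := by
    intro x hx
    have h1 := congrFun hg x
    have hxW : x ∉ W := fun hxW => absurd (hW x hxW) (not_le.mpr hx)
    simpa [innerMap, hxW, not_le.mpr hx] using h1
  have hbin : ∀ x, ℓ x ≤ r → b x = 0 := fun x hx => by simp [hb, fluxMap, hx]
  have hbout : ∀ x, r < ℓ x → b x = ∑ z, a x z * g z := fun x hx => by
    simp [hb, fluxMap, not_le.mpr hx]
  have hbsph : ∀ x, ℓ x ≠ r + 1 → b x = 0 := by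
    intro x hx
    by_cases hr : ℓ x ≤ r
    · exact hbin x hr
    rw [hbout x (not_le.mp hr)]
    refine Finset.sum_eq_zero fun z _ => ?_
    by_cases hz : a x z = 0
    · simp [hz]
    · have := hℓ x z hz
      rw [hgout z (by omega), mul_zero]
  have hvW : ∀ x ∈ W, v x = 0 := fun x hx => by simp [hv, hgW x hx]
  have hvu : ∀ x, r < ℓ x → v x = u x := fun x hx => by simp [hv, hgout x hx]
  have hres : ∀ x, x ∉ W → (ham a V β ω *ᵥ v) x - E * v x = (lam - E) * u x + b x := by
    intro x hx
    have e1 := congrFun hu x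
    rw [Pi.smul_apply, smul_eq_mul] at e1
    have e2 : (ham a V β ω *ᵥ v) x = lam * u x - (ham a V β ω *ᵥ g) x := by
      rw [hv, mulVec_sub, Pi.sub_apply, e1]
    rw [e2]
    by_cases hr : ℓ x ≤ r
    · have h1 := congrFun hg x
      simp only [innerMap, LinearMap.coe_mk, AddHom.coe_mk, hx, if_false, hr, if_true,
        Pi.zero_apply] at h1
      rw [hbin x hr, hv, Pi.sub_apply]; linarith
    · have hr' := not_le.mp hr
      rw [hbout x hr', hvu x hr', ham_mulVec, hgout x hr']; ring
  set t := √(∑ x, v x ^ 2) with ht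
  have hv0 : 0 ≤ ∑ x, v x ^ 2 := Finset.sum_nonneg fun x _ => sq_nonneg _
  have ht0 : 0 ≤ t := Real.sqrt_nonneg _
  have ht2 : t ^ 2 = ∑ x, v x ^ 2 := Real.sq_sqrt hv0
  have hvt : ∀ x, |v x| ≤ t := fun x => by
    refine abs_le_of_sq_le_sq ?_ ht0
    rw [ht2]
    exact Finset.single_le_sum (f := fun x => v x ^ 2) (fun y _ => sq_nonneg _) (Finset.mem_univ x)
  have hθt : θ ≤ t := by
    set A := Q ^ (2 * r + 1) with hA
    have h1 : ∀ x, |u x| ≤ A * t := abs_le_of_layers ha0 haD hβ hQ hD ω hc hnext hu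
      (hlam.trans hδ1) ht0 fun x hx => by rw [← hvu x hx]; exact hvt x
    have h2 : ∑ x, u x ^ 2 ≤ ∑ _x : n, (A * t) ^ 2 := Finset.sum_le_sum fun x _ => by
      rw [← sq_abs]; exact pow_le_pow_left₀ (abs_nonneg _) (h1 x) 2
    rw [hu1, Finset.sum_const, Finset.card_univ, nsmul_eq_mul] at h2
    set P := (Fintype.card n : ℝ) * A ^ 2 with hP
    have h3 : θ ^ 2 * P ≤ t ^ 2 * P := by rw [hP] at hθQ ⊢; nlinarith
    have hP0 : 0 < P := by
      have : 0 ≤ P := by positivity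
      rcases this.eq_or_lt with h | h
      · exfalso
        have : (Fintype.card n : ℝ) * (A * t) ^ 2 = P * t ^ 2 := by rw [hP]; ring
        rw [this, ← h] at h2; linarith
      · exact h
    exact (sq_le_sq₀ hθ.le ht0).mp (le_of_mul_le_mul_right h3 hP0)
  have htpos : 0 < t := hθ.trans_le hθt
  have hδt : δ ≤ κ * t / 2 := hδ.trans (by gcongr)
  have hlam2 : (lam - E) ^ 2 ≤ δ ^ 2 := by
    rw [← sq_abs]; exact pow_le_pow_left₀ (abs_nonneg _) hlam 2
  have hub : κ * t ^ 2 / 2 ≤ ∑ x, u x * b x := by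
    have h1 := le_quadForm_ham ha ha0 haD hV hβ ω hvW
    rw [← ht2] at h1
    have h2 : v ⬝ᵥ ham a V β ω *ᵥ v - E * t ^ 2 =
        (lam - E) * ∑ x, v x * u x + ∑ x, u x * b x := by
      rw [dotProduct, ht2, Finset.mul_sum, Finset.mul_sum, ← Finset.sum_sub_distrib,
        ← Finset.sum_add_distrib]
      refine Finset.sum_congr rfl fun x _ => ?_
      by_cases hx : x ∈ W
      · simp [hvW x hx, hbin x (hW x hx)]
      · have h3 := hres x hx
        have h4 : v x * b x = u x * b x := by
          by_cases hr : ℓ x ≤ r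
          · simp [hbin x hr]
          · rw [hvu x (not_le.mp hr)]
        linear_combination v x * h3 + h4
    have h5 : |∑ x, v x * u x| ≤ t := by
      refine abs_le.mpr (abs_le_of_sq_le_sq' ?_ ht0)
      have := Finset.sum_mul_sq_le_sq_mul_sq Finset.univ v u
      rwa [hu1, mul_one, ← ht2] at this
    have h6 : (lam - E) * ∑ x, v x * u x ≤ δ * t := by
      refine (le_abs_self _).trans ?_
      rw [abs_mul]
      exact mul_le_mul hlam h5 (abs_nonneg _) ((abs_nonneg _).trans hlam)
    have h7 : E * t ^ 2 + κ * t ^ 2 ≤ h * t ^ 2 := by nlinarith [sq_nonneg t]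
    nlinarith
  have hb2 : ∑ x, b x ^ 2 ≤ (2 * Q * t) ^ 2 := by
    have h1 : ∀ x, b x ^ 2 ≤
        2 * ((ham a V β ω *ᵥ v) x - E * v x) ^ 2 + 2 * δ ^ 2 * u x ^ 2 := by
      intro x
      by_cases hx : x ∈ W
      · rw [hbin x (hW x hx), zero_pow two_ne_zero]; positivity
      · have h3 := hres x hx
        rw [h3]
        nlinarith [sq_nonneg (b x + 2 * ((lam - E) * u x)),
          mul_le_mul_of_nonneg_right hlam2 (sq_nonneg (u x))]
    have h2 := Finset.sum_le_sum fun x (_ : x ∈ Finset.univ) => h1 x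
    rw [Finset.sum_add_distrib, ← Finset.mul_sum, ← Finset.mul_sum, hu1] at h2
    have h3 := sum_sq_ham_sub_le ha ha0 haD hD hβ hQ ω v
    rw [← ht2] at h3
    have h4 : δ ≤ Q * t / 2 := hδt.trans (by gcongr)
    have h5 : δ ^ 2 ≤ (Q * t / 2) ^ 2 :=
      pow_le_pow_left₀ ((abs_nonneg _).trans hlam) h4 2
    nlinarith [sq_nonneg (Q * t)]
  set L := Finset.univ.filter fun y => ℓ y = r + 1 ∧ η ≤ |u y| with hL
  have hsmall : ∑ x ∈ Lᶜ, u x * b x ≤ κ * t ^ 2 / 4 := by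
    have h1 : ∑ x ∈ Lᶜ, u x * b x ≤ ∑ x, η * |b x| := by
      refine (Finset.sum_le_sum fun x hx => ?_).trans
        (Finset.sum_le_sum_of_subset_of_nonneg (Finset.subset_univ _)
          fun x _ _ => mul_nonneg hη0 (abs_nonneg _))
      by_cases hs : ℓ x = r + 1
      · have h2 : |u x| < η := by
          simpa [hL, hs] using hx
        refine (le_abs_self _).trans ?_
        rw [abs_mul]
        exact mul_le_mul_of_nonneg_right h2.le (abs_nonneg _)
      · simp [hbsph x hs]
    have h2 : ∑ x, |b x| ≤ √(Fintype.card n) * (2 * Q * t) := by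
      have h3 := Finset.sum_mul_sq_le_sq_mul_sq Finset.univ (fun _ : n => (1 : ℝ)) fun x => |b x|
      simp only [one_mul, one_pow, Finset.sum_const, Finset.card_univ, nsmul_eq_mul, mul_one,
        sq_abs] at h3
      refine abs_le_of_sq_le_sq' ?_ (by positivity) |>.2
      rw [mul_pow, Real.sq_sqrt (Nat.cast_nonneg _)]
      exact h3.trans (mul_le_mul_of_nonneg_left hb2 (Nat.cast_nonneg _))
    rw [← Finset.mul_sum] at h1
    calc _ ≤ _ := h1
      _ ≤ η * (√(Fintype.card n) * (2 * Q * t)) := by gcongr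
      _ = (η * √(Fintype.card n) * (2 * Q)) * t := by ring
      _ ≤ (κ * θ / 4) * t := by gcongr
      _ ≤ (κ * t / 4) * t := by gcongr
      _ = _ := by ring
  have hLb : κ * t ^ 2 / 4 ≤ ∑ x ∈ L, u x * b x := by
    have := Finset.sum_add_sum_compl L fun x => u x * b x
    linarith
  have hcs := Finset.sum_mul_sq_le_sq_mul_sq L u b
  have hLu : ∑ x ∈ L, u x ^ 2 ≤ t ^ 2 := by
    rw [ht2]
    refine (Finset.sum_le_sum fun x hx => ?_).trans
      (Finset.sum_le_sum_of_subset_of_nonneg (Finset.subset_univ _) fun x _ _ => sq_nonneg _)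
    have : ℓ x = r + 1 := (Finset.mem_filter.mp hx).2.1
    rw [hvu x (by omega)]
  set lev := ∑ y ∈ L, leverage (fluxSpace a V β E W ℓ r ω) y with hlev
  have hlev0 : 0 ≤ lev := Finset.sum_nonneg fun y _ => leverage_nonneg _ _
  have hbmem : b ∈ fluxSpace a V β E W ℓ r ω := Submodule.mem_map_of_mem (LinearMap.mem_ker.mpr hg)
  have hLb2 : ∑ x ∈ L, b x ^ 2 ≤ lev * (2 * Q * t) ^ 2 := by
    refine (Finset.sum_le_sum fun x _ => sq_le_leverage hbmem x).trans ?_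
    rw [← Finset.sum_mul]
    exact mul_le_mul_of_nonneg_left hb2 hlev0
  have h1 : (κ * t ^ 2 / 4) ^ 2 ≤ t ^ 2 * (lev * (2 * Q * t) ^ 2) :=
    (pow_le_pow_left₀ (by positivity) hLb 2).trans (hcs.trans
      (mul_le_mul hLu hLb2 (Finset.sum_nonneg fun x _ => sq_nonneg _) (sq_nonneg t)))
  have h2 : κ ^ 2 ≤ lev * (8 * Q) ^ 2 := by
    have h3 : t ^ 4 * κ ^ 2 ≤ t ^ 4 * (lev * (8 * Q) ^ 2) := by nlinarith
    exact le_of_mul_le_mul_left h3 (by positivity)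
  rw [div_pow, div_le_iff₀ (by positivity)]
  exact h2

open Matrix in
/-- At most `#W` eigenvalues lie below the height of the barrier. -/
lemma eigCount_ham_le {n : Type*} [Fintype n] [DecidableEq n] {a : Matrix n n ℝ} {D h β z : ℝ}
    (ha : ∀ x y, a x y = a y x) (ha0 : ∀ x y, 0 ≤ a x y) (haD : ∀ x, ∑ y, a x y ≤ D)
    {V : n → ℝ} {W : Finset n} (hV : ∀ x, x ∉ W → D + h ≤ V x) (hβ : 0 ≤ β) (hz : z ≤ h)
    (ω : n → Bool) : eigCount (ham_isHermitian ha V β ω) 1 z ≤ W.card := by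
  classical
  set hA := ham_isHermitian ha V β ω
  obtain ⟨φ, ho, he, -⟩ := exists_eigenbasis hA
  let p : n → Prop := fun i => (1 : ℝ) * hA.eigenvalues i < 1 * z
  let f : ({i // p i} → ℝ) →ₗ[ℝ] (W → ℝ) :=
    (LinearMap.funLeft ℝ ℝ (Subtype.val : W → n)).comp (subComb φ p)
  have hf : Function.Injective f := by
    refine (injective_iff_map_eq_zero f).mpr fun c hc => ?_
    have h1 := le_quadForm_ham ha ha0 haD hV hβ ω (v := subComb φ p c)
      fun x hx => congrFun hc ⟨x, hx⟩
    have h0 : ∑ x, (subComb φ p c) x ^ 2 = (subComb φ p c) ⬝ᵥ (subComb φ p c) := by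
      simp [dotProduct, sq]
    rw [h0] at h1
    simp only [subComb, LinearMap.coe_mk, AddHom.coe_mk] at h1
    rw [eigenbasis_dotProduct_self ho, eigenbasis_quadForm ho he, Finset.mul_sum] at h1
    by_contra hne
    obtain ⟨i₀, hi₀⟩ := Function.ne_iff.mp hne
    refine absurd h1 (not_le.mpr (Finset.sum_lt_sum (fun i _ => ?_) ⟨i₀, Finset.mem_univ _, ?_⟩))
    · by_cases hi : p i
      · have hi' : hA.eigenvalues i < z := by simpa [p] using hi
        exact mul_le_mul_of_nonneg_right (hi'.le.trans hz) (sq_nonneg _)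
      · simp [hi]
    · have hi' : hA.eigenvalues i₀ < z := by simpa [p] using i₀.2
      refine mul_lt_mul_of_pos_right (hi'.trans_le hz) ?_
      have : c i₀ ≠ 0 := hi₀
      simp only [i₀.2, dif_pos]
      positivity
  have h := LinearMap.finrank_le_finrank_of_injective hf
  rw [Module.finrank_fintype_fun_eq_card, Module.finrank_fintype_fun_eq_card,
    Fintype.card_coe, Fintype.card_subtype] at h
  exact h

open Matrix in
lemma card_le_eigCount_ham {n : Type*} [Fintype n] [DecidableEq n] {a : Matrix n n ℝ}
    {D h β z : ℝ} (ha : ∀ x y, a x y = a y x) (ha0 : ∀ x y, 0 ≤ a x y)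
    (haD : ∀ x, ∑ y, a x y ≤ D) {V : n → ℝ} {W : Finset n} (hV : ∀ x, x ∉ W → D + h ≤ V x)
    (hβ : 0 ≤ β) (hz : z < h) (ω : n → Bool) :
    Fintype.card n ≤ eigCount (ham_isHermitian ha V β ω) (-1) z + W.card := by
  classical
  let f : ({x // x ∉ W} → ℝ) →ₗ[ℝ] (n → ℝ) :=
    { toFun := fun c x => if hx : x ∈ W then 0 else c ⟨x, hx⟩
      map_add' := fun c c' => by ext x; by_cases hx : x ∈ W <;> simp [hx]
      map_smul' := fun r c => by ext x; by_cases hx : x ∈ W <;> simp [hx] }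
  have h := card_le_eigCount (ham_isHermitian ha V β ω) (-1) z f fun c hc => by
    have h1 := le_quadForm_ham ha ha0 haD hV hβ ω (v := f c) fun x hx => by simp [f, hx]
    have h0 : ∑ x, (f c) x ^ 2 = f c ⬝ᵥ f c := by simp [dotProduct, sq]
    obtain ⟨x, hx⟩ := Function.ne_iff.mp hc
    have h2 : 0 < ∑ x, (f c) x ^ 2 := by
      refine Finset.sum_pos' (fun i _ => sq_nonneg _) ⟨x, Finset.mem_univ _, ?_⟩
      have h3 : f c x = c x := by simp [f, x.2]
      rw [h3]
      have : c x ≠ 0 := hx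
      positivity
    rw [← h0]
    nlinarith
  have h2 : Fintype.card {x // x ∉ W} = Fintype.card n - W.card := by
    rw [Fintype.card_subtype_compl, Fintype.card_coe]
  omega

lemma eigCount_le_card {n : Type*} [Fintype n] [DecidableEq n] {A : Matrix n n ℝ}
    (hA : A.IsHermitian) (σ z : ℝ) : eigCount hA σ z ≤ Fintype.card n :=
  Finset.card_le_univ _

open Matrix in
lemma quadForm_ham_flipAt {n : Type*} [Fintype n] [DecidableEq n] (a : Matrix n n ℝ) (V : n → ℝ)
    (β : ℝ) (ω : n → Bool) (y : n) (v : n → ℝ) :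
    v ⬝ᵥ ham a V β (flipAt y ω) *ᵥ v =
      v ⬝ᵥ ham a V β ω *ᵥ v + bitSign (ω y) * (β * v y ^ 2) := by
  have h : ∀ x, v x * (ham a V β (flipAt y ω) *ᵥ v) x = v x * (ham a V β ω *ᵥ v) x +
      if x = y then bitSign (ω y) * (β * v y ^ 2) else 0 := by
    intro x
    rw [ham_mulVec, ham_mulVec]
    by_cases hx : x = y
    · subst hx
      rw [flipAt_apply_self, if_pos rfl]
      cases ω x <;> simp [bitSign] <;> ring
    · rw [flipAt_apply_of_ne hx, if_neg hx, add_zero]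
  simp only [dotProduct, h, Finset.sum_add_distrib, Finset.sum_ite_eq', Finset.mem_univ, if_true]

/-- Counting function whose jumps detect the eigenvalues near `E`. -/
def levelCount {n : Type*} [Fintype n] [DecidableEq n] {a : Matrix n n ℝ}
    (ha : ∀ x y, a x y = a y x) (V : n → ℝ) (β E : ℝ) (δ : ℕ → ℝ) (M : ℕ) (ω : n → Bool) : ℝ :=
  ∑ j ∈ Finset.range (M + 1), ((eigCount (ham_isHermitian ha V β ω) 1 (E - δ j) : ℝ) +
    (Fintype.card n - eigCount (ham_isHermitian ha V β ω) (-1) (E + δ j)))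

lemma abs_levelCount_le {n : Type*} [Fintype n] [DecidableEq n] {a : Matrix n n ℝ}
    {D h β E : ℝ} (ha : ∀ x y, a x y = a y x) (ha0 : ∀ x y, 0 ≤ a x y)
    (haD : ∀ x, ∑ y, a x y ≤ D) {V : n → ℝ} {W : Finset n} (hV : ∀ x, x ∉ W → D + h ≤ V x)
    (hβ : 0 ≤ β) {δ : ℕ → ℝ} {M : ℕ} (hM : W.card ≤ M)
    (hδ0 : ∀ j ≤ M, 0 ≤ δ j) (hδ : ∀ j ≤ M, E + δ j < h) (ω : n → Bool) :
    |levelCount ha V β E δ M ω| ≤ 2 * M * (M + 1) := by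
  refine (Finset.abs_sum_le_sum_abs _ _).trans ?_
  have : ∀ j ∈ Finset.range (M + 1),
      |(eigCount (ham_isHermitian ha V β ω) 1 (E - δ j) : ℝ) +
      (Fintype.card n - eigCount (ham_isHermitian ha V β ω) (-1) (E + δ j))| ≤ 2 * M := by
    intro j hj
    have hj' : j ≤ M := by simpa [Nat.lt_succ_iff] using hj
    have h1 : (eigCount (ham_isHermitian ha V β ω) 1 (E - δ j) : ℝ) ≤ M := by
      exact_mod_cast (eigCount_ham_le ha ha0 haD hV hβ
        (by linarith [hδ0 j hj', hδ j hj']) ω).trans hM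
    have h2 : (Fintype.card n : ℝ) ≤
        eigCount (ham_isHermitian ha V β ω) (-1) (E + δ j) + M := by
      exact_mod_cast (card_le_eigCount_ham ha ha0 haD hV hβ (hδ j hj') ω).trans
        (Nat.add_le_add_left hM _)
    have h3 : (eigCount (ham_isHermitian ha V β ω) (-1) (E + δ j) : ℝ) ≤ Fintype.card n := by
      exact_mod_cast eigCount_le_card _ _ _
    have h4 : (0 : ℝ) ≤ eigCount (ham_isHermitian ha V β ω) 1 (E - δ j) := Nat.cast_nonneg _
    rw [abs_of_nonneg (by linarith)]
    linarith
  refine (Finset.sum_le_sum this).trans (le_of_eq ?_)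
  rw [Finset.sum_const, Finset.card_range, nsmul_eq_mul]
  push_cast; ring

lemma eigCount_flipAt_mono {n : Type*} [Fintype n] [DecidableEq n] {a : Matrix n n ℝ}
    (ha : ∀ x y, a x y = a y x) (V : n → ℝ) {β : ℝ} (hβ : 0 ≤ β) (σ z : ℝ)
    (ω : n → Bool) (y : n) :
    0 ≤ bitSign (ω y) * σ * ((eigCount (ham_isHermitian ha V β ω) σ z : ℝ) -
      eigCount (ham_isHermitian ha V β (flipAt y ω)) σ z) := by
  have hp : ∀ v : n → ℝ, 0 ≤ β * v y ^ 2 := fun v => by positivity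
  rcases le_total 0 (bitSign (ω y) * σ) with hs | hs
  · refine mul_nonneg hs (sub_nonneg.mpr (Nat.cast_le.mpr
      (eigCount_mono _ _ σ z fun v => ?_)))
    rw [quadForm_ham_flipAt]
    nlinarith [mul_nonneg hs (hp v)]
  · refine mul_nonneg_of_nonpos_of_nonpos hs (sub_nonpos.mpr (Nat.cast_le.mpr
      (eigCount_mono _ _ σ z fun v => ?_)))
    rw [quadForm_ham_flipAt]
    nlinarith [mul_nonneg (neg_nonneg.mpr hs) (hp v)]

lemma levelCount_flipAt {n : Type*} [Fintype n] [DecidableEq n] {a : Matrix n n ℝ}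
    (ha : ∀ x y, a x y = a y x) (V : n → ℝ) (β E : ℝ) (δ : ℕ → ℝ) (M : ℕ)
    (ω : n → Bool) (y : n) :
    bitSign (ω y) * (levelCount ha V β E δ M ω - levelCount ha V β E δ M (flipAt y ω)) =
      ∑ j ∈ Finset.range (M + 1),
        (bitSign (ω y) * 1 * ((eigCount (ham_isHermitian ha V β ω) 1 (E - δ j) : ℝ) -
            eigCount (ham_isHermitian ha V β (flipAt y ω)) 1 (E - δ j)) +
          bitSign (ω y) * (-1) * ((eigCount (ham_isHermitian ha V β ω) (-1) (E + δ j) : ℝ) -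
            eigCount (ham_isHermitian ha V β (flipAt y ω)) (-1) (E + δ j))) := by
  rw [levelCount, levelCount, ← Finset.sum_sub_distrib, Finset.mul_sum]
  exact Finset.sum_congr rfl fun j _ => by ring

lemma levelCount_flipAt_nonneg {n : Type*} [Fintype n] [DecidableEq n] {a : Matrix n n ℝ}
    (ha : ∀ x y, a x y = a y x) (V : n → ℝ) {β : ℝ} (hβ : 0 ≤ β) (E : ℝ) (δ : ℕ → ℝ) (M : ℕ)
    (ω : n → Bool) (y : n) :
    0 ≤ bitSign (ω y) *
      (levelCount ha V β E δ M ω - levelCount ha V β E δ M (flipAt y ω)) := by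
  rw [levelCount_flipAt]
  exact Finset.sum_nonneg fun j _ => add_nonneg (eigCount_flipAt_mono ha V hβ _ _ ω y)
    (eigCount_flipAt_mono ha V hβ _ _ ω y)

/-- Among `M + 1` consecutive windows, one contains no point of a family with `M` members. -/
lemma exists_empty_window {n : Type*} (s : Finset n) {M : ℕ} (hs : s.card ≤ M) (f : n → ℝ)
    {δ : ℕ → ℝ} (hδ : Monotone δ) :
    ∃ j ≤ M, ∀ i ∈ s, δ j < f i → δ (j + 1) ≤ f i := by
  by_contra! hcon
  have : Nonempty n := ⟨(hcon 0 (Nat.zero_le _)).choose⟩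
  choose! g hgs hg1 hg2 using hcon
  have hinj : Set.InjOn g (Finset.range (M + 1) : Set ℕ) := by
    intro j hj j' hj' hjj
    simp only [Finset.coe_range, Set.mem_Iio, Nat.lt_succ_iff] at hj hj'
    by_contra hne
    rcases Nat.lt_or_gt_of_ne hne with hlt | hlt
    · have := hδ (Nat.succ_le_of_lt hlt)
      linarith [hg1 j' hj', hg2 j hj, hjj ▸ hg2 j hj]
    · have := hδ (Nat.succ_le_of_lt hlt)
      linarith [hg1 j hj, hg2 j' hj', hjj.symm ▸ hg2 j' hj']
  have := Finset.card_le_card_of_injOn g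
    (fun j hj => hgs j (by simpa [Nat.lt_succ_iff] using hj)) hinj
  rw [Finset.card_range] at this
  omega

open Matrix in
/-- Flipping the bit at a site where an eigenfunction near `E` is not small changes the level
count. -/
lemma one_le_levelCount_flipAt {n : Type*} [Fintype n] [DecidableEq n] {a : Matrix n n ℝ}
    {D h β E η : ℝ} (ha : ∀ x y, a x y = a y x) (ha0 : ∀ x y, 0 ≤ a x y)
    (haD : ∀ x, ∑ y, a x y ≤ D) {V : n → ℝ} {W : Finset n} (hV : ∀ x, x ∉ W → D + h ≤ V x)
    (hβ : 0 < β) {δ : ℕ → ℝ} {M : ℕ} (hM : W.card ≤ M) (hδ0 : 0 < δ 0) (hδm : Monotone δ)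
    (hδβ : δ (M + 1) ≤ β) (hδh : E + δ (M + 1) ≤ h)
    (hδη : ∀ j, 4 * δ j < (δ (j + 1) - δ j) * η ^ 2) (hη0 : 0 ≤ η) (ω : n → Bool)
    {φ : n → n → ℝ} (ho : ∀ i j, φ i ⬝ᵥ φ j = if i = j then 1 else 0)
    (he : ∀ i, ham a V β ω *ᵥ φ i = (ham_isHermitian ha V β ω).eigenvalues i • φ i) {i₀ y : n}
    (hi₀ : |(ham_isHermitian ha V β ω).eigenvalues i₀ - E| ≤ δ 0) (hy : η ≤ |φ i₀ y|) :
    1 ≤ bitSign (ω y) *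
      (levelCount ha V β E δ M ω - levelCount ha V β E δ M (flipAt y ω)) := by
  set hA := ham_isHermitian ha V β ω with hhA
  have key : ∀ σ : ℝ, σ * σ = 1 → σ = -bitSign (ω y) → ∃ j ≤ M,
      eigCount hA σ (E - σ * δ j) + 1 ≤
        eigCount (ham_isHermitian ha V β (flipAt y ω)) σ (E - σ * δ j) := by
    intro σ hσ hσy
    set s := Finset.univ.filter fun i => (1 : ℝ) * hA.eigenvalues i < 1 * (E + δ (M + 1)) with hs
    have hsM : s.card ≤ M := (eigCount_ham_le ha ha0 haD hV hβ.le hδh ω).trans hM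
    obtain ⟨j, hjM, hj⟩ := exists_empty_window s hsM (fun i => σ * (E - hA.eigenvalues i)) hδm
    have hδpos : 0 < δ j := hδ0.trans_le (hδm (Nat.zero_le j))
    have hη2 : 0 ≤ η ^ 2 := sq_nonneg η
    have hg : 0 < δ (j + 1) - δ j := by
      by_contra hneg
      have := hδη j
      nlinarith [not_lt.mp hneg]
    have hjM1 : δ (j + 1) ≤ δ (M + 1) := hδm (by omega)
    have hσ1 : σ = 1 ∨ σ = -1 := mul_self_eq_one_iff.mp hσ
    refine ⟨j, hjM, eigCount_lt_of_rankOne hA _ σ _ (δ (j + 1) - δ j) β y hg hβ (fun v => ?_)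
      (fun i hi => ?_) ho he i₀ ?_ ?_⟩
    · rw [quadForm_ham_flipAt]
      have : bitSign (ω y) = -σ := by rw [hσy, neg_neg]
      rw [this]; linear_combination -(β * v y ^ 2) * hσ
    · have e1 : σ * (E - σ * δ j) = σ * E - δ j := by linear_combination -(δ j) * hσ
      rw [e1] at hi ⊢
      have hwin : δ j < σ * (E - hA.eigenvalues i) := by linarith
      by_cases his : i ∈ s
      · have := hj i his hwin
        linarith
      · have h1 : E + δ (M + 1) ≤ hA.eigenvalues i := by simpa [hs] using his
        rcases hσ1 with rfl | rfl <;> linarith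
    · have e1 : σ * (E - σ * δ j) = σ * E - δ j := by linear_combination -(δ j) * hσ
      rw [e1]
      have := hδm (Nat.zero_le j)
      rcases abs_le.mp hi₀ with ⟨h1, h2⟩
      rcases hσ1 with rfl | rfl <;> linarith
    · have e1 : σ * hA.eigenvalues i₀ - σ * (E - σ * δ j) ≤ 2 * δ j := by
        have e1 : σ * (E - σ * δ j) = σ * E - δ j := by linear_combination -(δ j) * hσ
        rw [e1]
        have := hδm (Nat.zero_le j)
        rcases abs_le.mp hi₀ with ⟨h1, h2⟩
        rcases hσ1 with rfl | rfl <;> linarith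
      have e2 : η ^ 2 ≤ φ i₀ y ^ 2 := by rw [← sq_abs (φ i₀ y)]; exact pow_le_pow_left₀ hη0 hy 2
      set g := δ (j + 1) - δ j with hgdef
      have e3 : g ≤ β := by linarith
      calc _ ≤ 2 * δ j * (g + β) := mul_le_mul_of_nonneg_right e1 (by linarith)
        _ ≤ 2 * δ j * (2 * β) := mul_le_mul_of_nonneg_left (by linarith) (by linarith)
        _ = (4 * δ j) * β := by ring
        _ < g * η ^ 2 * β := mul_lt_mul_of_pos_right (hδη j) hβ
        _ ≤ g * φ i₀ y ^ 2 * β := by gcongr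
        _ = _ := by ring
  rw [levelCount_flipAt]
  have hn1 := fun j => eigCount_flipAt_mono ha V hβ.le 1 (E - δ j) ω y
  have hn2 := fun j => eigCount_flipAt_mono ha V hβ.le (-1) (E + δ j) ω y
  cases hb : ω y with
  | false =>
    obtain ⟨j, hj, hlt⟩ := key (-1) (by norm_num) (by simp [hb, bitSign])
    rw [hb] at hn1 hn2
    refine le_trans ?_ (Finset.single_le_sum (fun j _ => add_nonneg (hn1 j) (hn2 j))
      (Finset.mem_range.mpr (Nat.lt_succ_of_le hj)))
    refine le_trans ?_ (le_add_of_nonneg_left (hn1 j))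
    have e : E - -1 * δ j = E + δ j := by ring
    rw [e] at hlt
    have hlt' : (eigCount hA (-1) (E + δ j) : ℝ) + 1 ≤
      eigCount (ham_isHermitian ha V β (flipAt y ω)) (-1) (E + δ j) := by exact_mod_cast hlt
    simp only [bitSign]
    simp only [Bool.false_eq_true, if_false]
    linarith
  | true =>
    obtain ⟨j, hj, hlt⟩ := key 1 (by norm_num) (by simp [hb, bitSign])
    rw [hb] at hn1 hn2
    refine le_trans ?_ (Finset.single_le_sum (fun j _ => add_nonneg (hn1 j) (hn2 j))
      (Finset.mem_range.mpr (Nat.lt_succ_of_le hj)))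
    refine le_trans ?_ (le_add_of_nonneg_right (hn2 j))
    rw [one_mul] at hlt
    have hlt' : (eigCount hA 1 (E - δ j) : ℝ) + 1 ≤
      eigCount (ham_isHermitian ha V β (flipAt y ω)) 1 (E - δ j) := by exact_mod_cast hlt
    simp only [bitSign, if_true]
    linarith

open Matrix in
/-- A finite-volume Wegner estimate: the number of configurations for which there is an
eigenvalue within `δ 0` of `E`. -/
lemma card_near_eigenvalue_le {n : Type*} [Fintype n] [DecidableEq n] {a : Matrix n n ℝ}
    {D Q h κ β E θ η : ℝ} (ha : ∀ x y, a x y = a y x)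
    (ha0 : ∀ x y, 0 ≤ a x y) (haD : ∀ x, ∑ y, a x y ≤ D) (hD : 0 ≤ D)
    {V : n → ℝ} {W : Finset n} (hV : ∀ x, x ∉ W → D + h ≤ V x) (hβ : 0 < β)
    (hQ : ∀ x, |V x| + β + |E| + 1 + D ≤ Q) (hκ : 0 < κ) (hκQ : κ ≤ Q) (hE : E + κ ≤ h)
    {ℓ : n → ℕ} (hℓ : ∀ x z, a x z ≠ 0 → ℓ x ≤ ℓ z + 1)
    {c : n → ℤ} (hc : ∀ x, |c x| ≤ ℓ x) {r₀ R : ℕ} (hW : ∀ x ∈ W, ℓ x ≤ r₀)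
    (hnext : ∀ x, ℓ x < r₀ + R → ∃ x', a x' x = 1 ∧ c x' = c x + 1 ∧
      ∀ z, a x' z ≠ 0 → z ≠ x → c x + 1 ≤ c z)
    {δ : ℕ → ℝ} {M : ℕ} (hM : W.card ≤ M) (hδ0 : 0 < δ 0) (hδm : Monotone δ)
    (hδβ : δ (M + 1) ≤ β) (hδ1 : δ 0 ≤ 1) (hδκ : δ (M + 1) < κ)
    (hδη : ∀ j, 4 * δ j < (δ (j + 1) - δ j) * η ^ 2) (hθ : 0 < θ) (hQ1 : 1 ≤ Q)
    (hθQ : θ ^ 2 * (Fintype.card n * (Q ^ (2 * (r₀ + R) + 1)) ^ 2) ≤ 1)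
    (hδθ : δ 0 ≤ κ * θ / 2)
    (hη0 : 0 ≤ η) (hη : η * √(Fintype.card n) * (2 * Q) ≤ κ * θ / 4)
    (B : Finset (n → Bool))
    (hB : ∀ ω ∈ B, ∃ i, |(ham_isHermitian ha V β ω).eigenvalues i - E| ≤ δ 0) :
    B.card * ((κ / (8 * Q)) ^ 2 * R) ≤
      2 * (2 * M * (M + 1)) * √(R * (M : ℝ) ^ 2) * 2 ^ Fintype.card n := by
  classical
  set lev : ℕ → (n → Bool) → n → ℝ := fun r ω => leverage (fluxSpace a V β E W ℓ r ω) with hlev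
  have hlev0 : ∀ r ω y, 0 ≤ lev r ω y := fun r ω y => leverage_nonneg _ y
  have hlevs : ∀ r ω, ∑ y, lev r ω y ≤ M := fun r ω => by
    simp only [hlev, sum_leverage]
    exact_mod_cast (finrank_fluxSpace_le ha ha0 haD hV hβ.le (by linarith) ℓ r ω).trans hM
  set w : n → (n → Bool) → ℝ := fun y ω =>
    ∑ r ∈ Finset.Ico r₀ (r₀ + R), if ℓ y = r + 1 then lev r ω y else 0 with hw
  have hδh : E + δ (M + 1) ≤ h := by linarith
  have hL : ∀ ω, ∃ L : Finset n, ω ∈ B → ((κ / (8 * Q)) ^ 2 * R ≤ ∑ y ∈ L, w y ω ∧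
      ∀ y ∈ L, 1 ≤ bitSign (ω y) *
        (levelCount ha V β E δ M ω - levelCount ha V β E δ M (flipAt y ω))) := by
    intro ω
    by_cases hωB : ω ∈ B
    swap
    · exact ⟨∅, fun h => absurd h hωB⟩
    obtain ⟨i₀, hi₀⟩ := hB ω hωB
    obtain ⟨φ, ho, he, -⟩ := exists_eigenbasis (ham_isHermitian ha V β ω)
    refine ⟨Finset.univ.filter fun y => η ≤ |φ i₀ y|, fun _ => ⟨?_, fun y hy => ?_⟩⟩
    · simp only [hw]
      rw [Finset.sum_comm]
      have hsph : ∀ r ∈ Finset.Ico r₀ (r₀ + R), (κ / (8 * Q)) ^ 2 ≤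
          ∑ y ∈ Finset.univ.filter fun y => η ≤ |φ i₀ y|,
            if ℓ y = r + 1 then lev r ω y else 0 := by
        intro r hr
        rw [Finset.mem_Ico] at hr
        rw [← Finset.sum_filter, Finset.filter_filter]
        have hu1 : ∑ x, φ i₀ x ^ 2 = 1 := by
          have := ho i₀ i₀
          simpa [dotProduct, sq] using this
        have hθr : θ ^ 2 * (Fintype.card n * (Q ^ (2 * r + 1)) ^ 2) ≤ 1 := by
          refine le_trans ?_ hθQ
          have : Q ^ (2 * r + 1) ≤ Q ^ (2 * (r₀ + R) + 1) := pow_le_pow_right₀ hQ1 (by omega)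
          gcongr
        have := le_sum_leverage ha ha0 haD hD hV hβ.le hQ hκ hκQ hE ω hℓ hc
          (fun x hx => (hW x hx).trans hr.1) (fun x hx => hnext x (by omega)) (he i₀) hu1 hi₀
          hδ1 hθ hθr hδθ hη0 hη
        simpa only [and_comm] using this
      have := Finset.sum_le_sum hsph
      rw [Finset.sum_const, Nat.card_Ico, nsmul_eq_mul] at this
      simpa [mul_comm] using this
    · exact one_le_levelCount_flipAt ha ha0 haD hV hβ hM hδ0 hδm hδβ hδh hδη hη0 ω ho he hi₀
        (by simpa using hy)
  choose L hL using hL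
  refine card_bad_le ℓ w (fun y ω => Finset.sum_nonneg fun r _ => ?_) (fun y ω ω' hωω => ?_)
    (levelCount ha V β E δ M) _ _ (R * (M : ℝ) ^ 2)
    (abs_levelCount_le ha ha0 haD hV hβ.le hM (fun j _ => (hδ0.le.trans (hδm (Nat.zero_le j))))
      fun j hj => by linarith [hδm (show j ≤ M + 1 by omega)])
    (levelCount_flipAt_nonneg ha V hβ.le E δ M) (fun ω => ?_) B L (fun ω hω => (hL ω hω).1)
    (fun ω hω => (hL ω hω).2)
  · split_ifs
    · exact hlev0 _ _ _
    · exact le_rfl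
  · refine Finset.sum_congr rfl fun r _ => ?_
    split_ifs with hr
    · simp only [hlev]
      rw [fluxSpace_congr a V β E W ℓ r fun x hx => hωω x (by omega)]
    · rfl
  · have hsq : ∀ y, w y ω ^ 2 =
        ∑ r ∈ Finset.Ico r₀ (r₀ + R), if ℓ y = r + 1 then lev r ω y ^ 2 else 0 := by
      intro y
      simp only [hw]
      cases hly : ℓ y with
      | zero => simp
      | succ m =>
        simp only [Nat.add_right_cancel_iff, Finset.sum_ite_eq]
        split_ifs <;> simp
    simp only [hsq]
    rw [Finset.sum_comm]
    have hsph : ∀ r ∈ Finset.Ico r₀ (r₀ + R),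
        ∑ y, (if ℓ y = r + 1 then lev r ω y ^ 2 else 0) ≤ (M : ℝ) ^ 2 := by
      intro r _
      calc ∑ y, (if ℓ y = r + 1 then lev r ω y ^ 2 else 0) ≤ ∑ y, lev r ω y ^ 2 :=
            Finset.sum_le_sum fun y _ => by split_ifs <;> [exact le_rfl; exact sq_nonneg _]
        _ ≤ (∑ y, lev r ω y) ^ 2 := Finset.sum_sq_le_sq_sum_of_nonneg fun y _ => hlev0 r ω y
        _ ≤ _ := pow_le_pow_left₀ (Finset.sum_nonneg fun y _ => hlev0 r ω y) (hlevs r ω) 2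
    refine (Finset.sum_le_sum hsph).trans (le_of_eq ?_)
    rw [Finset.sum_const, Nat.card_Ico, nsmul_eq_mul]
    simp

lemma linfDist_le_iff {x y : Site d} {r : ℕ} :
    linfDist x y ≤ r ↔ ∀ i, |x i - y i| ≤ r := by
  simp only [linfDist, Finset.sup_le_iff, Finset.mem_univ, true_implies]
  exact forall_congr' fun _ => by rw [Int.abs_eq_natAbs]; omega

lemma mem_boxF_iff {x c : Site d} {r : ℕ} : x ∈ boxF c r ↔ linfDist x c ≤ r := by
  rw [linfDist_le_iff, boxF, Fintype.mem_piFinset]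
  refine forall_congr' fun _ => ?_
  rw [Finset.mem_Icc, abs_le]
  constructor <;> rintro ⟨h1, h2⟩ <;> constructor <;> omega

lemma card_boxF (c : Site d) (r : ℕ) : (boxF c r).card = (2 * r + 1) ^ d := by
  have h : ∀ i, (Finset.Icc (c i - r) (c i + r)).card = 2 * r + 1 := fun _ => by
    rw [Int.card_Icc]; omega
  rw [boxF, Fintype.card_piFinset, Finset.prod_congr rfl fun i _ => h i]
  simp

lemma l1dist_comm (x y : Site d) : l1dist x y = l1dist y x :=
  Finset.sum_congr rfl fun _ _ => abs_sub_comm _ _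

lemma abs_sub_le_l1dist (x y : Site d) (i : Fin d) : |x i - y i| ≤ l1dist x y :=
  Finset.single_le_sum (f := fun i => |x i - y i|) (fun _ _ => abs_nonneg _) (Finset.mem_univ i)

lemma linfDist_le_of_adj {x y : Site d} (h : l1dist x y = 1) (j : Site d) :
    linfDist x j ≤ linfDist y j + 1 := by
  rw [linfDist_le_iff]
  intro i
  have h1 := abs_sub_le_l1dist x y i
  have h2 := linfDist_le_iff.mp (le_refl (linfDist y j)) i
  have h3 := abs_add_le (x i - y i) (y i - j i)
  rw [sub_add_sub_cancel] at h3
  push_cast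
  omega

lemma eq_add_or_sub_unit {x y : Site d} (h : l1dist x y = 1) :
    ∃ i, y = x + unit i ∨ y = x - unit i := by
  have hne : x ≠ y := by rintro rfl; simp [l1dist] at h
  obtain ⟨i, hi⟩ := Function.ne_iff.mp hne
  have h1 := Finset.add_sum_erase Finset.univ (fun i => |x i - y i|) (Finset.mem_univ i)
  have h0 : 0 ≤ ∑ k ∈ Finset.univ.erase i, |x k - y k| :=
    Finset.sum_nonneg fun _ _ => abs_nonneg _
  have h2 : 1 ≤ |x i - y i| := Int.one_le_abs (sub_ne_zero.mpr hi)
  rw [l1dist] at h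
  have h3 : |x i - y i| = 1 := by omega
  have h4 : ∀ k, k ≠ i → x k = y k := by
    intro k hk
    have h5 : ∑ k ∈ Finset.univ.erase i, |x k - y k| = 0 := by omega
    have := (Finset.sum_eq_zero_iff_of_nonneg fun _ _ => abs_nonneg _).mp h5 k
      (Finset.mem_erase.mpr ⟨hk, Finset.mem_univ k⟩)
    exact sub_eq_zero.mp (abs_eq_zero.mp this)
  refine ⟨i, ?_⟩
  rcases (abs_eq (zero_le_one' ℤ)).mp h3 with h6 | h6
  · right
    ext k
    by_cases hk : k = i
    · subst hk; simp [unit]; omega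
    · simp [unit, hk, h4 k hk]
  · left
    ext k
    by_cases hk : k = i
    · subst hk; simp [unit]; omega
    · simp [unit, hk, h4 k hk]

lemma l1dist_add_unit (x : Site d) (i : Fin d) : l1dist (x + unit i) x = 1 := by
  have : ∀ k, |(x + unit i) k - x k| = if k = i then 1 else 0 := fun k => by
    by_cases hk : k = i <;> simp [unit, hk]
  rw [l1dist, Finset.sum_congr rfl fun k _ => this k]
  simp

/-- The adjacency matrix of a finite set of sites. -/
def adjF (Λ : Finset (Site d)) : Matrix Λ Λ ℝ := fun x y =>
  if l1dist (x : Site d) (y : Site d) = 1 then 1 else 0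

lemma adjF_symm (Λ : Finset (Site d)) (x y : Λ) : adjF Λ x y = adjF Λ y x := by
  rw [adjF, adjF, l1dist_comm]

lemma adjF_nonneg (Λ : Finset (Site d)) (x y : Λ) : 0 ≤ adjF Λ x y := by
  rw [adjF]; split_ifs <;> norm_num

lemma adjF_ne_zero {Λ : Finset (Site d)} {x y : Λ} (h : adjF Λ x y ≠ 0) :
    l1dist (x : Site d) (y : Site d) = 1 := by
  by_contra hne
  exact h (if_neg hne)

lemma sum_adjF_le (Λ : Finset (Site d)) (x : Λ) : ∑ y, adjF Λ x y ≤ 2 * d := by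
  simp only [adjF]
  rw [Finset.sum_boole]
  have h : ((Finset.univ.filter fun y : Λ => l1dist (x : Site d) y = 1).card : ℝ) ≤
      ((Finset.univ : Finset (Fin d × Bool)).card : ℝ) := by
    refine Nat.cast_le.mpr ?_
    rw [← Finset.card_image_of_injective _ (Subtype.val_injective)]
    refine le_trans (Finset.card_le_card (t := (Finset.univ : Finset (Fin d × Bool)).image
      fun p => if p.2 then (x : Site d) + unit p.1 else (x : Site d) - unit p.1) ?_)
      Finset.card_image_le
    intro z hz
    obtain ⟨y, hy, rfl⟩ := Finset.mem_image.mp hz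
    obtain ⟨i, hi | hi⟩ := eq_add_or_sub_unit (Finset.mem_filter.mp hy).2
    · exact Finset.mem_image.mpr ⟨(i, true), Finset.mem_univ _, by simp [hi]⟩
    · exact Finset.mem_image.mpr ⟨(i, false), Finset.mem_univ _, by simp [hi]⟩
  refine h.trans (le_of_eq ?_)
  rw [Finset.card_univ, Fintype.card_prod, Fintype.card_fin, Fintype.card_bool]
  push_cast; ring

lemma HMat_eq_ham (Vhi : Site d → ℝ) (β : ℝ) (ω : Site d → Bool) (Λ : Finset (Site d)) :
    HMat Vhi β ω Λ = ham (adjF Λ) (fun x => 2 * d + Vhi x) β fun x => ω x := by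
  ext x y
  simp only [HMat, ham, adjF, Matrix.sub_apply, Matrix.diagonal_apply]

lemma exists_next {Λ : Finset (Site d)} (i₀ : Fin d) (j : Site d) (x : Λ)
    (hx : (x : Site d) + unit i₀ ∈ Λ) :
    ∃ x' : Λ, adjF Λ x' x = 1 ∧ (x' : Site d) i₀ - j i₀ = (x : Site d) i₀ - j i₀ + 1 ∧
      ∀ z : Λ, adjF Λ x' z ≠ 0 → z ≠ x →
        (x : Site d) i₀ - j i₀ + 1 ≤ (z : Site d) i₀ - j i₀ := by
  refine ⟨⟨x + unit i₀, hx⟩, if_pos (l1dist_add_unit _ _), ?_, fun z hz hzx => ?_⟩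
  · simp [unit]; ring
  · obtain ⟨i, hi | hi⟩ := eq_add_or_sub_unit (adjF_ne_zero hz)
    · rw [hi]
      by_cases hii : i₀ = i <;> simp [unit, hii]
    · by_cases hii : i₀ = i
      · subst hii
        exact absurd (Subtype.ext (by simpa using hi)) hzx
      · rw [hi]; simp [unit, hii]

/-- A hierarchical zero set has few points. -/
lemma exists_finset_of_isHierIn {d₀ α : ℝ} {N : ℕ} {W : Set (Site d)} (k : ℕ) :
    ∀ j, IsHierIn d₀ α N W (k + 1) j →
      ∃ F : Finset (Site d), W ∩ LambdaS d₀ α (k + 1) j ⊆ F ∧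
        F.card ≤ (2 * (4 * ⌊3 * d₀⌋).toNat + 1) ^ d * N ^ (k + 1) := by
  classical
  induction k with
  | zero =>
    rintro j ⟨m, C, hm, hW, hdiam, -, -⟩
    have hF : ∀ s, ∃ F : Finset (Site d), C s ⊆ F ∧
        F.card ≤ (2 * (4 * ⌊3 * d₀⌋).toNat + 1) ^ d := by
      intro s
      rcases (C s).eq_empty_or_nonempty with h | ⟨c, hc⟩
      · exact ⟨∅, by simp [h]⟩
      · refine ⟨boxF c ((4 * ⌊3 * d₀⌋).toNat : ℕ), fun x hx => ?_, (card_boxF _ _).le⟩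
        have := hdiam s x hx c hc
        exact Finset.mem_coe.mpr (mem_boxF_iff.mpr (by omega))
    choose F hF1 hF2 using hF
    refine ⟨Finset.univ.biUnion F, ?_, ?_⟩
    · rw [hW]
      refine Set.iUnion_subset fun s x hx => ?_
      exact Finset.mem_coe.mpr (Finset.mem_biUnion.mpr ⟨s, Finset.mem_univ s, hF1 s hx⟩)
    · refine (Finset.card_biUnion_le_card_mul _ _ _ fun s _ => hF2 s).trans ?_
      rw [Finset.card_univ, Fintype.card_fin, mul_comm, zero_add, pow_one]
      exact Nat.mul_le_mul_left _ hm
  | succ k ih =>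
    rintro j ⟨m, C, hm, hW, hC0, -, hj, hjs⟩
    have hF : ∀ s, ∃ F : Finset (Site d), C s ⊆ F ∧
        F.card ≤ (2 * (4 * ⌊3 * d₀⌋).toNat + 1) ^ d * N ^ (k + 1) := by
      intro s
      have hCW : C s ⊆ W := fun x hx => by
        have : x ∈ W ∩ LambdaS d₀ α (k + 2) j := by
          rw [hW]; exact Set.mem_iUnion.mpr ⟨s, hx⟩
        exact this.1
      by_cases hs : s = 0
      · obtain ⟨F, hF1, hF2⟩ := ih j hj
        exact ⟨F, fun x hx => hF1 ⟨hCW hx, hC0 (hs ▸ hx)⟩, hF2⟩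
      · obtain ⟨js, -, h2, h3⟩ := hjs s hs
        obtain ⟨F, hF1, hF2⟩ := ih js h3
        exact ⟨F, fun x hx => hF1 ⟨hCW hx, h2 hx⟩, hF2⟩
    choose F hF1 hF2 using hF
    refine ⟨Finset.univ.biUnion F, ?_, ?_⟩
    · rw [hW]
      refine Set.iUnion_subset fun s x hx => ?_
      exact Finset.mem_coe.mpr (Finset.mem_biUnion.mpr ⟨s, Finset.mem_univ s, hF1 s hx⟩)
    · refine (Finset.card_biUnion_le_card_mul _ _ _ fun s _ => hF2 s).trans ?_
      rw [Finset.card_univ, Fintype.card_fin]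
      exact (Nat.mul_le_mul_right _ hm).trans (le_of_eq (by ring))

open MeasureTheory in
/-- Probabilities of events depending on finitely many sites are bounded by counting. -/
lemma measure_le_card {ℙ : Measure (Site d → Bool)} (hℙ : IsBernoulliProduct d ℙ)
    (Λ : Finset (Site d)) (B : Finset (Λ → Bool)) {p : ℝ}
    (hB : B.card ≤ p * 2 ^ Fintype.card Λ) :
    ℙ {ω | (fun x : Λ => ω x) ∈ B} ≤ ENNReal.ofReal p := by
  classical
  let e : (Λ → Bool) → Site d → Bool := fun v x => if hx : x ∈ Λ then v ⟨x, hx⟩ else false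
  have hsub : {ω : Site d → Bool | (fun x : Λ => ω x) ∈ B} ⊆
      ⋃ v ∈ B, {ω | ∀ x ∈ Λ, ω x = e v x} := by
    intro ω hω
    exact Set.mem_biUnion (x := fun x : Λ => ω x) hω fun x hx => by simp [e, hx]
  refine (measure_mono hsub).trans ((measure_biUnion_finset_le _ _).trans ?_)
  have h1 : ∀ v ∈ B, ℙ {ω | ∀ x ∈ Λ, ω x = e v x} = ENNReal.ofReal ((1 / 2) ^ Λ.card) := by
    intro v _
    rw [hℙ Λ (e v), ENNReal.ofReal_pow (by norm_num), ENNReal.ofReal_div_of_pos (by norm_num)]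
    simp
  rw [Finset.sum_congr rfl h1, Finset.sum_const, nsmul_eq_mul, ← ENNReal.ofReal_natCast,
    ← ENNReal.ofReal_mul (Nat.cast_nonneg _)]
  refine ENNReal.ofReal_le_ofReal ?_
  rw [Fintype.card_coe] at hB
  calc (B.card : ℝ) * (1 / 2) ^ Λ.card ≤ p * 2 ^ Λ.card * (1 / 2) ^ Λ.card := by gcongr
    _ = p := by rw [mul_assoc, ← mul_pow]; norm_num

open Filter in
lemma eventually_mul_rpow_le (C : ℝ) {a b : ℝ} (hab : a < b) :
    ∀ᶠ t : ℝ in atTop, C * t ^ a ≤ t ^ b := by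
  filter_upwards [(tendsto_rpow_atTop (sub_pos.mpr hab)).eventually_ge_atTop C,
    eventually_gt_atTop 0] with t h1 h2
  calc C * t ^ a ≤ t ^ (b - a) * t ^ a := by gcongr
    _ = t ^ b := by rw [← Real.rpow_add h2, sub_add_cancel]

open Filter in
lemma eventually_pow_le_exp_rpow (m : ℕ) {γ : ℝ} (hγ : 0 < γ) :
    ∀ᶠ t : ℝ in atTop, (3 * t) ^ m ≤ Real.exp (t ^ γ) := by
  have h := (isLittleO_log_rpow_atTop hγ).bound (show (0 : ℝ) < 1 / (2 * m + 1) by positivity)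
  filter_upwards [h, eventually_ge_atTop 3] with t h1 h2
  have ht : 0 < t := by linarith
  have hlog : 0 ≤ Real.log t := Real.log_nonneg (by linarith)
  have hT : 0 ≤ t ^ γ := by positivity
  rw [Real.norm_of_nonneg hlog, Real.norm_of_nonneg hT, div_mul_eq_mul_div, one_mul,
    le_div_iff₀ (by positivity)] at h1
  calc (3 * t) ^ m ≤ (t * t) ^ m := by gcongr
    _ = Real.exp (Real.log t * (2 * m)) := by
      rw [← pow_two, ← pow_mul, ← Real.rpow_natCast, Real.rpow_def_of_pos ht]; push_cast; rfl
    _ ≤ Real.exp (t ^ γ) := Real.exp_le_exp.mpr (by nlinarith)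

lemma nscale_succ_rpow {d₀ α : ℝ} (hd₀ : 1 < d₀) (hα : 1 < α) (k : ℕ) :
    nscale d₀ α (k + 1) ^ (1 / α) = nscale d₀ α k := by
  rw [nscale, nscale, ← Real.rpow_mul (by linarith), pow_succ, mul_assoc, mul_one_div_cancel
    (by linarith), mul_one]

open Filter in
lemma tendsto_nscale {d₀ α : ℝ} (hd₀ : 1 < d₀) (hα : 1 < α) :
    Tendsto (nscale d₀ α) atTop atTop :=
  (tendsto_rpow_atTop_of_base_gt_one d₀ hd₀).comp (tendsto_pow_atTop_atTop_of_one_lt hα)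

open Filter in
/-- Exponential quantities are negligible with respect to the scales. -/
lemma eventually_mul_pow_le_nscale {d₀ α p : ℝ} (hd₀ : 1 < d₀) (hα : 1 < α) (hp : 0 < p)
    {K N : ℕ} (hK : 1 ≤ K) (hN : 1 ≤ N) :
    ∀ᶠ k : ℕ in atTop, ((K * N ^ k : ℕ) : ℝ) ≤ nscale d₀ α (k + 1) ^ p := by
  have hK' : (1 : ℝ) ≤ K := by exact_mod_cast hK
  have hN' : (1 : ℝ) ≤ N := by exact_mod_cast hN
  set c := Real.log K + Real.log N with hc
  have hc0 : 0 ≤ c := add_nonneg (Real.log_nonneg hK') (Real.log_nonneg hN')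
  have hl : 0 < Real.log d₀ := Real.log_pos hd₀
  have h := (tendsto_pow_const_div_const_pow_of_one_lt 1 hα).comp (tendsto_add_atTop_nat 1)
  have h2 := h.eventually_lt_const (show (0 : ℝ) < p * Real.log d₀ / (c + 1) by positivity)
  filter_upwards [h2] with k hk
  have hαk : 0 < α ^ (k + 1) := by positivity
  simp only [Function.comp_apply, pow_one] at hk
  rw [div_lt_div_iff₀ hαk (by linarith)] at hk
  have h3 : ((K * N ^ k : ℕ) : ℝ) = Real.exp (Real.log K + k * Real.log N) := by
    rw [Real.exp_add, Real.exp_log (by linarith), mul_comm (k : ℝ), Real.exp_mul,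
      Real.exp_log (by linarith), Real.rpow_natCast]
    push_cast; rfl
  have h4 : nscale d₀ α (k + 1) ^ p = Real.exp (p * Real.log d₀ * α ^ (k + 1)) := by
    rw [nscale, ← Real.rpow_mul (by linarith), Real.rpow_def_of_pos (by linarith)]
    congr 1; ring
  rw [h3, h4]
  refine Real.exp_le_exp.mpr ?_
  have h5 : Real.log K ≤ (k + 1) * Real.log K := by
    nlinarith [Real.log_nonneg hK', (Nat.cast_nonneg k : (0 : ℝ) ≤ k)]
  push_cast at hk
  have h6 : Real.log K + k * Real.log N ≤ (k + 1) * c := by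
    rw [hc]; nlinarith [Real.log_nonneg hN']
  nlinarith [(Nat.cast_nonneg k : (0 : ℝ) ≤ k)]

set_option maxHeartbeats 1000000 in
/-- A choice of parameters in the finite-volume estimate at a large scale `t`. -/
lemma exists_parameters {t s γ ε p κ β Q : ℝ} {m M r₀ ρ : ℕ} (ht : 1 ≤ t)
    (hγ2 : 2 ≤ t ^ γ) (hs : 6 * s ≤ t ^ γ) (hγt : 10 * t ^ γ ≤ t)
    (hr₀ : (r₀ : ℝ) ≤ 6 * s) (hρ : (r₀ : ℤ) + ⌊t / 10⌋ = ρ)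
    (hexp : (3 * t) ^ m ≤ Real.exp (t ^ γ)) (hβ : 0 < β) (hκ : 0 < κ) (hQ : 1 ≤ Q)
    (hM1 : 1 ≤ M) (hM : (M : ℝ) ≤ t ^ p)
    (hε1 : 2 * (4 * (5 * Real.log Q + 4) * t ^ (γ + p)) ≤ t ^ (1 - ε)) (hp : 0 < p)
    (hε2 : 2 * -Real.log (min β (κ / 2)) ≤ t ^ (1 - ε))
    (hη : Real.log (8 * Q / κ) ≤ t ^ γ)
    (hfin : 16 * t ^ (3 * p + 1 / 16) ≤ (κ / (8 * Q)) ^ 2 * t ^ (γ / 2)) :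
    ∃ (R : ℕ) (θ η : ℝ) (δ : ℕ → ℝ), r₀ + R ≤ ρ ∧ δ 0 = Real.exp (-t ^ (1 - ε)) ∧ Monotone δ ∧
      δ (M + 1) ≤ β ∧ δ (M + 1) < κ ∧ (∀ j, 4 * δ j < (δ (j + 1) - δ j) * η ^ 2) ∧ 0 < θ ∧
      θ ^ 2 * (((2 * ρ + 1) ^ m : ℕ) * (Q ^ (2 * (r₀ + R) + 1)) ^ 2) ≤ 1 ∧
      δ 0 ≤ κ * θ / 2 ∧ 0 ≤ η ∧
      η * √((2 * ρ + 1) ^ m : ℕ) * (2 * Q) ≤ κ * θ / 4 ∧ 0 < R ∧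
      2 * (2 * M * (M + 1)) * √(R * (M : ℝ) ^ 2) ≤
        t ^ (-(1 / 16) : ℝ) * ((κ / (8 * Q)) ^ 2 * R) := by
  have ht0 : 0 < t := by linarith
  set T := t ^ γ with hT
  set C := 5 * Real.log Q + 1 with hC
  have hlogQ : 0 ≤ Real.log Q := Real.log_nonneg hQ
  set R := ⌊T⌋₊ with hR
  have hRT : (R : ℝ) ≤ T := Nat.floor_le (by linarith)
  have hTR : T < R + 1 := Nat.lt_floor_add_one T
  have hρR : (ρ : ℝ) ≤ r₀ + t / 10 := by
    have h1 : ((ρ : ℤ) : ℝ) = (r₀ : ℝ) + (⌊t / 10⌋ : ℝ) := by rw [← hρ]; push_cast; rfl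
    have h2 := Int.floor_le (t / 10)
    push_cast at h1
    linarith
  have hn : (((2 * ρ + 1) ^ m : ℕ) : ℝ) ≤ Real.exp T := by
    refine le_trans ?_ hexp
    push_cast
    refine pow_le_pow_left₀ (by positivity) ?_ m
    linarith
  set n : ℝ := (((2 * ρ + 1) ^ m : ℕ) : ℝ) with hnn
  have hn0 : 0 ≤ n := Nat.cast_nonneg _
  have hA : Q ^ (2 * (r₀ + R) + 1) ≤ Real.exp (5 * Real.log Q * T) := by
    rw [← Real.rpow_natCast, Real.rpow_def_of_pos (by linarith)]
    refine Real.exp_le_exp.mpr ?_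
    have : ((2 * (r₀ + R) + 1 : ℕ) : ℝ) ≤ 5 * T := by push_cast; linarith
    nlinarith
  have hδ0 : 0 < Real.exp (-t ^ (1 - ε)) := Real.exp_pos _
  set δ : ℕ → ℝ := fun j => Real.exp (-t ^ (1 - ε)) * (6 * Real.exp (2 * (C + 2) * T)) ^ j with hδ
  have hmin : 0 < min β (κ / 2) := lt_min hβ (by linarith)
  have hratio : 1 ≤ 6 * Real.exp (2 * (C + 2) * T) := by
    have : 1 ≤ Real.exp (2 * (C + 2) * T) := Real.one_le_exp (by positivity)
    linarith
  have hp1 : 1 ≤ t ^ p := Real.one_le_rpow ht hp.le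
  have hpT : t ^ (γ + p) = T * t ^ p := by rw [hT, Real.rpow_add ht0]
  have hδM : δ (M + 1) ≤ min β (κ / 2) := by
    have h6 : (6 : ℝ) ≤ Real.exp 2 := by
      have h1 := Real.exp_one_gt_d9
      have h2 : Real.exp 2 = Real.exp 1 * Real.exp 1 := by rw [← Real.exp_add]; norm_num
      rw [h2]; nlinarith
    calc δ (M + 1) ≤ Real.exp (-t ^ (1 - ε)) *
          (Real.exp 2 * Real.exp (2 * (C + 2) * T)) ^ (M + 1) := by simp only [hδ]; gcongr
      _ = Real.exp (-t ^ (1 - ε) + ((M : ℝ) + 1) * (2 + 2 * (C + 2) * T)) := by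
          rw [← Real.exp_add, ← Real.exp_nat_mul, ← Real.exp_add]; push_cast; rfl
      _ ≤ Real.exp (Real.log (min β (κ / 2))) := by
          refine Real.exp_le_exp.mpr ?_
          have h7 : ((M : ℝ) + 1) * (2 + 2 * (C + 2) * T) ≤
              (2 * t ^ p) * (2 * T + 2 * (C + 2) * T) := by
            apply mul_le_mul <;> first | positivity | linarith
          have h8 : (2 * t ^ p) * (2 * T + 2 * (C + 2) * T) =
              4 * (5 * Real.log Q + 4) * t ^ (γ + p) := by rw [hpT, hC]; ring
          linarith
      _ = _ := Real.exp_log hmin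
  have hη1 : Real.exp (-(C + 2) * T) ^ 2 * Real.exp (2 * (C + 2) * T) = 1 := by
    rw [← Real.exp_nat_mul, ← Real.exp_add, ← Real.exp_zero]; congr 1; push_cast; ring
  refine ⟨R, Real.exp (-C * T), Real.exp (-(C + 2) * T), δ, ?_, by simp [hδ], ?_,
    hδM.trans (min_le_left _ _), (hδM.trans (min_le_right _ _)).trans_lt (by linarith), fun j => ?_,
    Real.exp_pos _, ?_, ?_, (Real.exp_pos _).le, ?_, ?_, ?_⟩
  · have h1 : (R : ℤ) ≤ ⌊t / 10⌋ := Int.le_floor.mpr (by push_cast; linarith)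
    omega
  · intro i j hij
    exact mul_le_mul_of_nonneg_left (pow_le_pow_right₀ hratio hij) hδ0.le
  · have hδj : 0 < δ j := by positivity
    have e : δ (j + 1) = δ j * (6 * Real.exp (2 * (C + 2) * T)) := by
      simp only [hδ]; rw [pow_succ]; ring
    have h1 : Real.exp (-(C + 2) * T) ^ 2 ≤ 1 :=
      pow_le_one₀ (Real.exp_pos _).le (Real.exp_le_one_iff.mpr (by
        have : 0 ≤ (C + 2) * T := by positivity
        linarith))
    have h2 : (δ (j + 1) - δ j) * Real.exp (-(C + 2) * T) ^ 2 =
        6 * δ j - δ j * Real.exp (-(C + 2) * T) ^ 2 := by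
      rw [e]; linear_combination (6 * δ j) * hη1
    rw [h2]
    nlinarith
  · calc Real.exp (-C * T) ^ 2 * (n * (Q ^ (2 * (r₀ + R) + 1)) ^ 2) ≤
          Real.exp (-C * T) ^ 2 * (Real.exp T * Real.exp (5 * Real.log Q * T) ^ 2) := by gcongr
      _ = Real.exp (-T) := by
          rw [← Real.exp_nat_mul, ← Real.exp_nat_mul, ← Real.exp_add, ← Real.exp_add, hC]
          congr 1; push_cast; ring
      _ ≤ 1 := Real.exp_le_one_iff.mpr (by linarith)
  · have h1 : δ 0 = Real.exp (-t ^ (1 - ε)) := by simp [hδ]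
    rw [h1]
    have h2 : κ * Real.exp (-C * T) / 2 = Real.exp (Real.log (κ / 2) + -C * T) := by
      rw [Real.exp_add, Real.exp_log (by linarith)]; ring
    rw [h2]
    refine Real.exp_le_exp.mpr ?_
    have h3 : Real.log (min β (κ / 2)) ≤ Real.log (κ / 2) :=
      Real.log_le_log hmin (min_le_right _ _)
    have h4 : C * T ≤ 4 * (5 * Real.log Q + 4) * t ^ (γ + p) := by
      rw [hpT, hC]
      have h5 : T ≤ T * t ^ p := le_mul_of_one_le_right (by linarith) hp1
      nlinarith
    linarith
  · have h1 : √n ≤ Real.exp T := by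
      refine Real.sqrt_le_iff.mpr ⟨(Real.exp_pos _).le, hn.trans ?_⟩
      have : 1 ≤ Real.exp T := Real.one_le_exp (by linarith)
      nlinarith
    have h2 : 8 * Q / κ ≤ Real.exp T := by
      rw [← Real.exp_log (show 0 < 8 * Q / κ by positivity)]
      exact Real.exp_le_exp.mpr hη
    have h3 : 8 * Q ≤ Real.exp T * κ := (div_le_iff₀ hκ).mp h2
    calc Real.exp (-(C + 2) * T) * √n * (2 * Q) ≤
          Real.exp (-(C + 2) * T) * Real.exp T * (Real.exp T * κ / 4) := by
          gcongr; linarith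
      _ = Real.exp (-(C + 2) * T + T + T) * κ / 4 := by
          rw [Real.exp_add, Real.exp_add]; ring
      _ = _ := by
          have : -(C + 2) * T + T + T = -C * T := by ring
          rw [this]; ring
  · exact Nat.floor_pos.mpr (by linarith)
  · have hM1' : (1 : ℝ) ≤ M := by exact_mod_cast hM1
    have hM0 : (0 : ℝ) ≤ M := by linarith
    rw [Real.sqrt_mul (Nat.cast_nonneg _), Real.sqrt_sq hM0]
    set c₁ := (κ / (8 * Q)) ^ 2 with hc₁
    have hR0 : (0 : ℝ) ≤ R := Nat.cast_nonneg _
    have h1 : t ^ (γ / 2) ≤ 2 * √R := by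
      have h2 : t ^ (γ / 2) = √T := by
        rw [hT, Real.sqrt_eq_rpow, ← Real.rpow_mul ht0.le]; congr 1; ring
      have h3 : √4 = 2 := by
        rw [show (4 : ℝ) = 2 ^ 2 by norm_num]; exact Real.sqrt_sq (by norm_num)
      rw [h2, ← h3, ← Real.sqrt_mul (by norm_num)]
      exact Real.sqrt_le_sqrt (by linarith)
    have h3 : (M : ℝ) ^ 3 ≤ t ^ (3 * p) := by
      calc (M : ℝ) ^ 3 ≤ (t ^ p) ^ 3 := pow_le_pow_left₀ hM0 hM 3
        _ = t ^ (3 * p) := by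
          rw [← Real.rpow_natCast, ← Real.rpow_mul ht0.le]; congr 1; push_cast; ring
    have hq : 0 < t ^ (-(1 / 16) : ℝ) := Real.rpow_pos_of_pos ht0 _
    have h4 : t ^ (3 * p) = t ^ (-(1 / 16) : ℝ) * t ^ (3 * p + 1 / 16) := by
      rw [← Real.rpow_add ht0]; congr 1; ring
    have h5 : 8 * t ^ (3 * p) ≤ t ^ (-(1 / 16) : ℝ) * (c₁ * √R) := by
      rw [h4]
      have h6 : 16 * t ^ (3 * p + 1 / 16) ≤ c₁ * (2 * √R) :=
        hfin.trans (mul_le_mul_of_nonneg_left h1 (by positivity))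
      nlinarith
    have h7 : 2 * (2 * M * (M + 1)) * (√R * M) ≤ 8 * (M : ℝ) ^ 3 * √R := by
      have h8 : (M : ℝ) * (M + 1) * M ≤ 2 * M ^ 3 := by
        nlinarith [mul_nonneg (sq_nonneg (M : ℝ)) (sub_nonneg.mpr hM1')]
      have := mul_le_mul_of_nonneg_right h8 (Real.sqrt_nonneg (R : ℝ))
      linarith
    calc 2 * (2 * M * (M + 1)) * (√R * M) ≤ 8 * (M : ℝ) ^ 3 * √R := h7
      _ ≤ (8 * t ^ (3 * p)) * √R := by gcongr
      _ ≤ t ^ (-(1 / 16) : ℝ) * (c₁ * √R) * √R := by gcongr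
      _ = t ^ (-(1 / 16) : ℝ) * (c₁ * R) := by
        rw [mul_assoc, mul_assoc c₁, Real.mul_self_sqrt hR0]

open MeasureTheory in
/-- **Wegner estimate for `d = 1, 2, 3`** (Theorem 3.2).

There are `q, ε > 0` and a scale `k_in`, depending only on `h, β, α, d₀, N` (and `d`),
such that for every hierarchical potential, every `k ≥ k_in`, every level-`k` block
`Λ_k(j)` of the hierarchical structure (i.e. every center `j` such that `V_hi` is
`(k,N)`-hierarchical in `Λ_k(j)` and the annulus `Λ̄_k(j) ∖ Λ_k(j)` lies in the barrier;
this covers both `Λ̄_k` and the `Λ̄_k^s`), and every energy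
`E ∈ [-ι/2, 4d+β+ι/2]`, the probability that `H_{Λ̄_k(j)}` has an eigenvalue within
`exp(-d_{k+1}^{1-ε})` of `E` is at most `d_{k+1}^{-q}`. -/
theorem wegner_estimate_low_dim
    (d : ℕ) (hd1 : 1 ≤ d) (hd3 : d ≤ 3)
    (d₀ α : ℝ) (hd₀ : 1 < d₀) (hα : 1 < α)
    (N : ℕ) (hN : 1 ≤ N)
    (h : ℝ) (hh : 4 * (d : ℝ) + 1 < h)
    (β : ℝ) (hβ0 : 0 < β) (hβ1 : β ≤ 1) :
    ∃ (q ε : ℝ) (kin : ℕ), 0 < q ∧ 0 < ε ∧ 0 < kin ∧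
      ∀ Vhi : Site d → ℝ, IsHierPot d₀ α N h Vhi →
      ∀ ℙ : Measure (Site d → Bool), IsProbabilityMeasure ℙ → IsBernoulliProduct d ℙ →
      ∀ k : ℕ, kin ≤ k →
      ∀ j : Site d, IsHierIn d₀ α N {x | Vhi x = 0} k j →
        (∀ x ∈ barLambdaF d₀ α k j, x ∉ LambdaS d₀ α k j → Vhi x = h) →
      ∀ E : ℝ, E ∈ Set.Icc (-(iota d h β) / 2) (4 * (d : ℝ) + β + iota d h β / 2) →
        ℙ {ω | ∃ μ ∈ spectrum ℝ (HMat Vhi β ω (barLambdaF d₀ α k j)),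
            |μ - E| < Real.exp (-(nscale d₀ α (k + 1) ^ (1 - ε)))} ≤
          ENNReal.ofReal (nscale d₀ α (k + 1) ^ (-q)) := by
  have hα0 : 0 < α := by linarith
  set ε : ℝ := (1 - 1 / α) / 4 with hε
  have hα1 : 1 / α < 1 := (div_lt_one hα0).mpr hα
  have hα2 : 0 < 1 / α := by positivity
  have hε0 : 0 < ε := by linarith
  set γ : ℝ := 1 - 2 * ε with hγ
  set p : ℝ := min (ε / 2) (1 / 32) with hp
  have hp0 : 0 < p := lt_min (by linarith) (by norm_num)
  have hpε : p ≤ ε / 2 := min_le_left _ _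
  have hp32 : p ≤ 1 / 32 := min_le_right _ _
  have hd0 : (0 : ℝ) ≤ d := Nat.cast_nonneg d
  set κ : ℝ := iota d h β with hκ
  have hκ0 : 0 < κ := lt_min (by norm_num) (by linarith)
  have hκ1 : κ ≤ 1 / 100 := min_le_left _ _
  have hκ2 : κ ≤ (h - 4 * d - β) / 2 := min_le_right _ _
  set Q : ℝ := h + 8 * d + 4 with hQ
  have hQ1 : 1 ≤ Q := by linarith
  set K : ℕ := (2 * (4 * ⌊3 * d₀⌋).toNat + 1) ^ d with hK
  have hc₁ : 0 < (κ / (8 * Q)) ^ 2 := by positivity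
  have hscale : Filter.Tendsto (fun k => nscale d₀ α (k + 1)) Filter.atTop Filter.atTop :=
    (tendsto_nscale hd₀ hα).comp (Filter.tendsto_add_atTop_nat 1)
  obtain ⟨kin, hkin⟩ := Filter.eventually_atTop.mp <|
    (hscale.eventually <| ((Filter.eventually_ge_atTop (1 : ℝ)).and <|
      (eventually_mul_rpow_le 2 (show 0 < γ by linarith)).and <|
      (eventually_mul_rpow_le 6 (show 1 / α < γ by linarith)).and <|
      (eventually_mul_rpow_le 10 (show γ < 1 by linarith)).and <|
      (eventually_pow_le_exp_rpow d (show 0 < γ by linarith)).and <|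
      (eventually_mul_rpow_le (2 * (4 * (5 * Real.log Q + 4)))
        (show γ + p < 1 - ε by linarith)).and <|
      (eventually_mul_rpow_le (2 * -Real.log (min β (κ / 2)))
        (show 0 < 1 - ε by linarith)).and <|
      (eventually_mul_rpow_le (Real.log (8 * Q / κ)) (show 0 < γ by linarith)).and <|
      eventually_mul_rpow_le (16 / (κ / (8 * Q)) ^ 2)
        (show 3 * p + 1 / 16 < γ / 2 by linarith))).and <|
    eventually_mul_pow_le_nscale hd₀ hα hp0 (K := K) (N := N) (Nat.one_le_pow _ _ (by omega)) hN
  refine ⟨1 / 16, ε, kin + 1, by norm_num, hε0, by omega, ?_⟩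
  intro Vhi hVhi ℙ _ hℙ k hk j hj hann E hE
  obtain ⟨⟨h1, h2, h3, h4, h5, h6, h7, h8, h9⟩, h10⟩ := hkin k (by omega)
  rw [nscale_succ_rpow hd₀ hα] at h3
  set t := nscale d₀ α (k + 1) with ht
  have ht0 : 0 < t := lt_of_lt_of_le one_pos h1
  rw [Real.rpow_zero, mul_one] at h2 h7 h8
  rw [Real.rpow_one] at h4
  rw [div_mul_eq_mul_div, div_le_iff₀ hc₁] at h9
  set s := nscale d₀ α k with hs
  have hs0 : 0 < s := Real.rpow_pos_of_pos (by linarith) _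
  have hfl : 0 ≤ ⌊3 * s⌋ := Int.floor_nonneg.mpr (by positivity)
  have hfl' : 0 ≤ ⌊t / 10⌋ := Int.floor_nonneg.mpr (by positivity)
  obtain ⟨r₀, hr₀⟩ := Int.eq_ofNat_of_zero_le (show 0 ≤ 2 * ⌊3 * s⌋ by omega)
  obtain ⟨ρ, hρ⟩ := Int.eq_ofNat_of_zero_le (show 0 ≤ 2 * ⌊3 * s⌋ + ⌊t / 10⌋ by omega)
  have hΛ : barLambdaF d₀ α k j = boxF j ρ := by rw [barLambdaF, ← hρ]
  have hM1 : 1 ≤ K * N ^ k :=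
    Nat.mul_pos (pow_pos (by omega) _) (pow_pos hN _)
  obtain ⟨R, θ, η, δ, hR, hδ0, hδm, hδβ, hδκ, hδη, hθ, hθQ, hδθ, hη0, hη, hR0, hend⟩ :=
    exists_parameters (t := t) (s := s) (γ := γ) (ε := ε) (p := p) (κ := κ) (β := β) (Q := Q)
      (m := d) (M := K * N ^ k) (r₀ := r₀) (ρ := ρ) h1 h2 h3 h4
      (by
        have e1 : ((r₀ : ℤ) : ℝ) = 2 * (⌊3 * s⌋ : ℝ) := by rw [← hr₀]; push_cast; rfl
        have e2 := Int.floor_le (3 * s)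
        push_cast at e1
        linarith)
      (by omega) h5 hβ0 hκ0 hQ1 hM1 h10 (by linarith) hp0 h7 h8 (by linarith)
  rw [hΛ] at hann ⊢
  have hcard : Fintype.card (boxF j (ρ : ℤ)) = (2 * ρ + 1) ^ d := by
    rw [Fintype.card_coe, card_boxF]
  rw [← hcard] at hθQ hη
  set Λ := boxF j (ρ : ℤ) with hΛ'
  let W : Finset Λ := Finset.univ.filter fun x => Vhi x = 0
  have hlam : ∀ x : Site d, x ∈ LambdaS d₀ α k j ↔ linfDist x j ≤ r₀ := fun x => by
    rw [LambdaS, Set.mem_ofPred_eq, ← hs, hr₀]; exact Nat.cast_le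
  have hWΛ : ∀ x ∈ W, (x : Site d) ∈ LambdaS d₀ α k j := fun x hx => by
    by_contra hx'
    have e1 := hann x x.2 hx'
    have e2 : Vhi x = 0 := (Finset.mem_filter.mp hx).2
    linarith
  have hWcard : W.card ≤ K * N ^ k := by
    obtain ⟨k', rfl⟩ : ∃ k', k = k' + 1 := ⟨k - 1, by omega⟩
    obtain ⟨F, hF, hFc⟩ := exists_finset_of_isHierIn k' j hj
    refine le_trans ?_ hFc
    rw [← Finset.card_map (Function.Embedding.subtype _)]
    refine Finset.card_le_card fun x hx => ?_
    obtain ⟨y, hy, rfl⟩ := Finset.mem_map.mp hx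
    exact hF ⟨(Finset.mem_filter.mp hy).2, hWΛ y hy⟩
  classical
  have hsymm := adjF_symm Λ
  let V : Λ → ℝ := fun x => 2 * d + Vhi x
  let B : Finset (Λ → Bool) := Finset.univ.filter fun ω =>
    ∃ i, |(ham_isHermitian hsymm V β ω).eigenvalues i - E| ≤ δ 0
  have hι : 0 < iota d h β := hκ0
  obtain ⟨hE1, hE2⟩ := hE
  have hmain := card_near_eigenvalue_le (a := adjF Λ) (D := 2 * d) (Q := Q) (h := h) (κ := κ)
    (β := β) (E := E) (θ := θ) (η := η) hsymm (adjF_nonneg Λ) (sum_adjF_le Λ) (by positivity)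
    (V := V) (W := W)
    (fun x hx => by
      rcases hVhi.1 x with h0 | h0
      · exact absurd (Finset.mem_filter.mpr ⟨Finset.mem_univ x, h0⟩ : x ∈ W) hx
      · simp [V, h0])
    hβ0
    (fun x => by
      have e1 : |V x| ≤ 2 * d + h := by
        rcases hVhi.1 x with h0 | h0 <;> simp only [V, h0] <;> rw [abs_of_nonneg] <;> linarith
      have e2 : |E| ≤ 4 * d + 2 := abs_le.mpr ⟨by linarith, by linarith⟩
      linarith)
    hκ0 (by linarith) (by linarith)
    (ℓ := fun x => linfDist (x : Site d) j)
    (fun x z hxz => linfDist_le_of_adj (adjF_ne_zero hxz) j)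
    (c := fun x => (x : Site d) ⟨0, hd1⟩ - j ⟨0, hd1⟩)
    (fun x => by
      have := linfDist_le_iff.mp (le_refl (linfDist (x : Site d) j)) ⟨0, hd1⟩
      exact_mod_cast this)
    (r₀ := r₀) (R := R) (fun x hx => (hlam x).mp (hWΛ x hx))
    (fun x hx => exists_next ⟨0, hd1⟩ j x <| mem_boxF_iff.mpr <|
      (linfDist_le_of_adj (l1dist_add_unit _ _) j).trans (by omega))
    (δ := δ) hWcard (by rw [hδ0]; exact Real.exp_pos _) hδm hδβ
    (by rw [hδ0]; exact Real.exp_le_one_iff.mpr (neg_nonpos.mpr (by positivity)))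
    hδκ hδη hθ hQ1 hθQ hδθ hη0 hη B (fun ω hω => (Finset.mem_filter.mp hω).2)
  have hB : (B.card : ℝ) ≤ t ^ (-(1 / 16) : ℝ) * 2 ^ Fintype.card Λ := by
    have hpos : 0 < (κ / (8 * Q)) ^ 2 * R := mul_pos hc₁ (by exact_mod_cast hR0)
    refine le_of_mul_le_mul_right ?_ hpos
    refine hmain.trans ?_
    calc _ ≤ t ^ (-(1 / 16) : ℝ) * ((κ / (8 * Q)) ^ 2 * R) * 2 ^ Fintype.card Λ := by gcongr
      _ = _ := by ring
  refine (measure_mono fun ω hω => ?_).trans (measure_le_card hℙ Λ B hB)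
  obtain ⟨μ, hμ, hμE⟩ := hω
  rw [HMat_eq_ham, (ham_isHermitian hsymm V β _).spectrum_real_eq_range_eigenvalues] at hμ
  obtain ⟨i, rfl⟩ := hμ
  exact Finset.mem_filter.mpr ⟨Finset.mem_univ _, i, by rw [hδ0]; exact hμE.le⟩

end HierABM
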